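/- Fix p ∈ (0,1) and for each k ∈ ℕ set n = n_k = ⌊(1/(1−p))^k · k⌋. Then there exists a constant c > 0 such that for all sufficiently large k, the second moment of X(k,k,k) under G(n_k, p) satisfies E[X(k,k,k)²] ≤ c·k³. -/

import Mathlib

open MeasureTheory Filter Real

noncomputable instance simpleGraphMeasurableSpace {n : ℕ} :
    MeasurableSpace (SimpleGraph (Fin n)) := ⊤

/-- The binomial random graph `G(n,p)`: the measure on simple graphs on `Fin n`
assigning to each graph `G` the probability `p^{e(G)} * (1-p)^{n(n-1)/2 - e(G)}`. -/
noncomputable def gnp (n : ℕ) (p : ℝ) : Measure (SimpleGraph (Fin n)) :=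
  Measure.sum fun G : SimpleGraph (Fin n) =>
    ENNReal.ofReal (p ^ Nat.card G.edgeSet *
      (1 - p) ^ (n * (n - 1) / 2 - Nat.card G.edgeSet)) • Measure.dirac G

/-- The tuple `(X₁,x₁,X₂,x₂,X₃,x₃)` is special: the `Xᵢ` are pairwise disjoint, `xᵢ ∈ Xᵢ`,
every vertex outside `X₁ ∪ X₂ ∪ X₃` has a neighbor in each `Xᵢ`, and for distinct `i,j`
the only edge between `Xᵢ` and `Xⱼ` is `{xᵢ, xⱼ}`. -/
def SpecialTuple {n : ℕ} (G : SimpleGraph (Fin n)) (X₁ X₂ X₃ : Finset (Fin n))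
    (x₁ x₂ x₃ : Fin n) : Prop :=
  Disjoint X₁ X₂ ∧ Disjoint X₁ X₃ ∧ Disjoint X₂ X₃ ∧
  x₁ ∈ X₁ ∧ x₂ ∈ X₂ ∧ x₃ ∈ X₃ ∧
  (∀ v : Fin n, v ∉ X₁ → v ∉ X₂ → v ∉ X₃ →
    (∃ u ∈ X₁, G.Adj v u) ∧ (∃ u ∈ X₂, G.Adj v u) ∧ (∃ u ∈ X₃, G.Adj v u)) ∧
  (∀ u ∈ X₁, ∀ v ∈ X₂, (G.Adj u v ↔ u = x₁ ∧ v = x₂)) ∧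
  (∀ u ∈ X₁, ∀ v ∈ X₃, (G.Adj u v ↔ u = x₁ ∧ v = x₃)) ∧
  (∀ u ∈ X₂, ∀ v ∈ X₃, (G.Adj u v ↔ u = x₂ ∧ v = x₃))

/-- `X(k,ℓ,m)`: the number of special tuples `(X₁,x₁,X₂,x₂,X₃,x₃)` with
`|X₁| = k`, `|X₂| = ℓ`, `|X₃| = m`. -/
noncomputable def countX {n : ℕ} (G : SimpleGraph (Fin n)) (k l m : ℕ) : ℕ :=
  Nat.card {t : Finset (Fin n) × Finset (Fin n) × Finset (Fin n) × Fin n × Fin n × Fin n //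
    t.1.card = k ∧ t.2.1.card = l ∧ t.2.2.1.card = m ∧
    SpecialTuple G t.1 t.2.1 t.2.2.1 t.2.2.2.1 t.2.2.2.2.1 t.2.2.2.2.2}

/-- The expectation of `X(k,ℓ,m)` under `G(n,p)`. -/
noncomputable def expX (n : ℕ) (p : ℝ) (k l m : ℕ) : ℝ :=
  ∫ G, (countX G k l m : ℝ) ∂ gnp n p

/-- The sequence `n_k = ⌊(1/(1-p))^k · k⌋`. -/
noncomputable def nseq2 (p : ℝ) (k : ℕ) : ℕ :=
  Nat.floor ((1 / (1 - p)) ^ k * (k : ℝ))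

noncomputable def gnpWeight (n : ℕ) (p : ℝ) (G : SimpleGraph (Fin n)) : ℝ :=
  p ^ Nat.card G.edgeSet * (1 - p) ^ (n * (n - 1) / 2 - Nat.card G.edgeSet)

lemma gnpWeight_nonneg {n : ℕ} {p : ℝ} (h0 : 0 ≤ p) (h1 : p ≤ 1) (G : SimpleGraph (Fin n)) :
    0 ≤ gnpWeight n p G :=
  mul_nonneg (pow_nonneg h0 _) (pow_nonneg (sub_nonneg.2 h1) _)

lemma integral_gnp {n : ℕ} {p : ℝ} (h0 : 0 ≤ p) (h1 : p ≤ 1) (f : SimpleGraph (Fin n) → ℝ) :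
    ∫ G, f G ∂gnp n p = ∑ G, gnpWeight n p G * f G := by
  have hm : ∀ g : SimpleGraph (Fin n) → ℝ, Measurable g := fun g => measurable_from_top
  have hs : ∀ g : SimpleGraph (Fin n) → ℝ, StronglyMeasurable g := fun g =>
    (hm g).stronglyMeasurable
  rw [gnp, Measure.sum_fintype, integral_finsetSum_measure]
  · refine Finset.sum_congr rfl fun G _ => ?_
    rw [integral_smul_measure, integral_dirac' _ _ (hs f),
      ← gnpWeight, ENNReal.toReal_ofReal (gnpWeight_nonneg h0 h1 G), smul_eq_mul]
  · intro G _
    refine Integrable.smul_measure ?_ ENNReal.ofReal_ne_top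
    exact (integrable_dirac' (hs f) (by simp))

open Classical in
/-- The indicator of the event that no pair in `F` is an edge of `G`. -/
noncomputable def avoidInd {V : Type*} (G : SimpleGraph V) (F : Finset (Sym2 V)) : ℝ :=
  if ∀ e ∈ F, e ∉ G.edgeSet then 1 else 0

lemma avoidInd_nonneg {V : Type*} (G : SimpleGraph V) (F : Finset (Sym2 V)) :
    0 ≤ avoidInd G F := by
  unfold avoidInd; split_ifs <;> norm_num

lemma avoidInd_union {V : Type*} [DecidableEq V] (G : SimpleGraph V) (F F' : Finset (Sym2 V)) :
    avoidInd G (F ∪ F') = avoidInd G F * avoidInd G F' := by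
  have h : (∀ e ∈ F ∪ F', e ∉ G.edgeSet) ↔
      (∀ e ∈ F, e ∉ G.edgeSet) ∧ ∀ e ∈ F', e ∉ G.edgeSet := Finset.forall_mem_union
  unfold avoidInd
  by_cases h1 : ∀ e ∈ F, e ∉ G.edgeSet
  · rw [if_pos h1, one_mul]
    by_cases h2 : ∀ e ∈ F', e ∉ G.edgeSet
    · rw [if_pos h2, if_pos (h.2 ⟨h1, h2⟩)]
    · rw [if_neg h2, if_neg fun h' => h2 (h.1 h').2]
  · rw [if_neg h1, if_neg fun h' => h1 (h.1 h').1, zero_mul]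

lemma sum_gnpWeight_mul_avoidInd {n : ℕ} (p : ℝ) (F : Finset (Sym2 (Fin n)))
    (hF : ∀ e ∈ F, ¬ e.IsDiag) :
    ∑ G, gnpWeight n p G * avoidInd G F = (1 - p) ^ F.card := by
  classical
  set E : Finset (Sym2 (Fin n)) := (⊤ : SimpleGraph (Fin n)).edgeFinset with hE
  have hmemE : ∀ e, e ∈ E ↔ ¬ e.IsDiag := by
    intro e; simp [hE]
  have hEcard : E.card = n * (n - 1) / 2 := by
    rw [hE, SimpleGraph.card_edgeFinset_top_eq_card_choose_two, Fintype.card_fin,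
      Nat.choose_two_right]
  have hFE : F ⊆ E := fun e he => (hmemE e).2 (hF e he)
  have h1 : ∑ G, gnpWeight n p G * avoidInd G F
      = ∑ S ∈ (E \ F).powerset, p ^ S.card * (1 - p) ^ (E.card - S.card) := by
    simp only [avoidInd, mul_ite, mul_one, mul_zero]
    rw [← Finset.sum_filter]
    refine Finset.sum_bij' (fun G _ => G.edgeFinset)
      (fun S _ => SimpleGraph.fromEdgeSet (S : Set (Sym2 (Fin n)))) ?_ ?_ ?_ ?_ ?_
    · intro G hG
      simp only [Finset.mem_filter, Finset.mem_univ, true_and] at hG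
      rw [Finset.mem_powerset]
      intro e he
      rw [SimpleGraph.mem_edgeFinset] at he
      exact Finset.mem_sdiff.2 ⟨(hmemE e).2 (G.not_isDiag_of_mem_edgeSet he),
        fun h => hG e h he⟩
    · intro S hS
      rw [Finset.mem_powerset] at hS
      simp only [Finset.mem_filter, Finset.mem_univ, true_and]
      intro e he h
      rw [SimpleGraph.edgeSet_fromEdgeSet] at h
      exact (Finset.mem_sdiff.1 (hS h.1)).2 he
    · intro G _
      simp
    · intro S hS
      rw [Finset.mem_powerset] at hS
      ext e
      simp only [SimpleGraph.mem_edgeFinset, SimpleGraph.edgeSet_fromEdgeSet]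
      exact ⟨fun h => h.1, fun h => ⟨h, (hmemE e).1 (Finset.mem_sdiff.1 (hS h)).1⟩⟩
    · intro G _
      rw [gnpWeight, hEcard, Nat.card_eq_fintype_card, SimpleGraph.edgeFinset_card]
  rw [h1]
  have h2 : ∀ S ∈ (E \ F).powerset, p ^ S.card * (1 - p) ^ (E.card - S.card)
      = (1 - p) ^ F.card * (p ^ S.card * (1 - p) ^ ((E \ F).card - S.card)) := by
    intro S hS
    have hSc := Finset.card_le_card (Finset.mem_powerset.1 hS)
    have : E.card - S.card = F.card + ((E \ F).card - S.card) := by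
      have := Finset.card_sdiff_add_card_eq_card hFE
      omega
    rw [this, pow_add]; ring
  rw [Finset.sum_congr rfl h2, ← Finset.mul_sum, Finset.sum_pow_mul_eq_add_pow]
  simp

/-- The pairs joining `v` to the elements of `Z`. -/
def starPairs {V : Type*} [DecidableEq V] (v : V) (Z : Finset V) : Finset (Sym2 V) :=
  Z.image fun u => s(v, u)

lemma card_starPairs {V : Type*} [DecidableEq V] (v : V) (Z : Finset V) :
    (starPairs v Z).card = Z.card :=
  Finset.card_image_of_injective _ fun _ _ h => Sym2.congr_right.1 h

lemma sum_gnpWeight_mul_prod_star {n : ℕ} (p : ℝ) {ι : Type*} [Fintype ι] (coef : ι → ℝ)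
    (Z : ι → Finset (Fin n)) (O : Finset (Fin n)) (hZ : ∀ c, Disjoint (Z c) O) :
    ∀ F : Finset (Sym2 (Fin n)), (∀ e ∈ F, ¬ e.IsDiag) → (∀ e ∈ F, ∀ v ∈ O, v ∉ e) →
    ∑ G, gnpWeight n p G * (avoidInd G F * ∏ v ∈ O, ∑ c, coef c * avoidInd G (starPairs v (Z c)))
      = (1 - p) ^ F.card * (∑ c, coef c * (1 - p) ^ (Z c).card) ^ O.card := by
  induction O using Finset.induction_on with
  | empty =>
    intro F hF _
    simp [sum_gnpWeight_mul_avoidInd p F hF]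
  | insert v O hv ih =>
    intro F hF hFO
    have hZO : ∀ c, Disjoint (Z c) O := fun c =>
      (hZ c).mono_right (Finset.subset_insert _ _)
    have hvZ : ∀ c, v ∉ Z c := fun c h =>
      Finset.disjoint_left.1 (hZ c) h (Finset.mem_insert_self _ _)
    have key : ∀ c, ∑ G, gnpWeight n p G * (avoidInd G (F ∪ starPairs v (Z c)) *
        ∏ v ∈ O, ∑ c, coef c * avoidInd G (starPairs v (Z c)))
        = (1 - p) ^ F.card * (1 - p) ^ (Z c).card *
          (∑ c, coef c * (1 - p) ^ (Z c).card) ^ O.card := by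
      intro c
      rw [ih hZO, Finset.card_union_of_disjoint, card_starPairs, pow_add]
      · rw [Finset.disjoint_right]
        intro e he heF
        obtain ⟨u, hu, rfl⟩ := Finset.mem_image.1 he
        exact hFO _ heF v (Finset.mem_insert_self _ _) (Sym2.mem_mk_left _ _)
      · intro e he
        rcases Finset.mem_union.1 he with he | he
        · exact hF e he
        · obtain ⟨u, hu, rfl⟩ := Finset.mem_image.1 he
          rw [Sym2.mk_isDiag_iff]
          rintro rfl
          exact hvZ c hu
      · intro e he w hw
        rcases Finset.mem_union.1 he with he | he
        · exact hFO e he w (Finset.mem_insert_of_mem hw)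
        · obtain ⟨u, hu, rfl⟩ := Finset.mem_image.1 he
          rw [Sym2.mem_iff, not_or]
          refine ⟨fun h => hv (h ▸ hw), fun h => ?_⟩
          exact Finset.disjoint_left.1 (hZO c) hu (h ▸ hw)
    have hG : ∀ G, gnpWeight n p G * (avoidInd G F *
        ∏ v ∈ insert v O, ∑ c, coef c * avoidInd G (starPairs v (Z c)))
        = ∑ c, coef c * (gnpWeight n p G * (avoidInd G (F ∪ starPairs v (Z c)) *
        ∏ v ∈ O, ∑ c, coef c * avoidInd G (starPairs v (Z c)))) := by
      intro G
      rw [Finset.prod_insert hv, Finset.sum_mul, Finset.mul_sum, Finset.mul_sum]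
      refine Finset.sum_congr rfl fun c _ => ?_
      rw [avoidInd_union]; ring
    rw [Finset.sum_congr rfl fun G _ => hG G, Finset.sum_comm]
    simp_rw [← Finset.mul_sum, key]
    rw [Finset.card_insert_of_notMem hv, pow_succ,
      mul_comm ((∑ c, coef c * (1 - p) ^ (Z c).card) ^ O.card), ← mul_assoc, Finset.mul_sum,
      Finset.sum_mul]
    refine Finset.sum_congr rfl fun c _ => ?_
    ring

/-- The coefficients of the second Bonferroni inequality. -/
noncomputable def bonferroniCoef {ι : Type*} [DecidableEq ι] : Option (ι × ι) → ℝ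
  | none => 1
  | some (a, b) => if a = b then -1 else 1 / 2

def bonferroniSet {ι V : Type*} [DecidableEq V] (D : ι → Finset V) :
    Option (ι × ι) → Finset V
  | none => ∅
  | some (a, b) => D a ∪ D b

lemma sum_bonferroniCoef_mul {ι : Type*} [DecidableEq ι] [Fintype ι]
    (f : Option (ι × ι) → ℝ) :
    ∑ c, bonferroniCoef c * f c =
      f none + ∑ a, ∑ b, (if a = b then -1 else 1 / 2 : ℝ) * f (some (a, b)) := by
  rw [Fintype.sum_option, Fintype.sum_prod_type]
  simp only [bonferroniCoef, one_mul]

lemma sum_ite_mul_mul_eq {ι : Type*} [DecidableEq ι] [Fintype ι] (m : ι → ℝ)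
    (hm : ∀ a, m a = 0 ∨ m a = 1) :
    ∑ a, ∑ b, (if a = b then -1 else 1 / 2 : ℝ) * (m a * m b) =
      (∑ a, m a) ^ 2 / 2 - 3 / 2 * ∑ a, m a := by
  have h1 : ∀ a b, (if a = b then -1 else 1 / 2 : ℝ) * (m a * m b)
      = 1 / 2 * (m a * m b) - (if a = b then 3 / 2 * m b else 0) := by
    intro a b
    split_ifs with h
    · subst h
      rcases hm a with h | h <;> rw [h] <;> norm_num
    · ring
  simp_rw [h1, Finset.sum_sub_distrib, Finset.sum_ite_eq, Finset.mem_univ, if_true,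
    ← Finset.mul_sum, ← Finset.sum_mul]
  ring

lemma avoidInd_eq_zero_or_one {V : Type*} (G : SimpleGraph V) (F : Finset (Sym2 V)) :
    avoidInd G F = 0 ∨ avoidInd G F = 1 := by
  unfold avoidInd; split_ifs <;> simp

lemma avoidInd_starPairs_eq_zero {V : Type*} [DecidableEq V] {G : SimpleGraph V} {v : V}
    {Z : Finset V} (h : ∃ u ∈ Z, G.Adj v u) : avoidInd G (starPairs v Z) = 0 := by
  obtain ⟨u, hu, huv⟩ := h
  exact if_neg fun h => h s(v, u) (Finset.mem_image_of_mem _ hu) huv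

lemma starPairs_union {V : Type*} [DecidableEq V] (v : V) (Z Z' : Finset V) :
    starPairs v (Z ∪ Z') = starPairs v Z ∪ starPairs v Z' := Finset.image_union _ _

lemma sum_bonferroniCoef_mul_avoidInd {ι V : Type*} [DecidableEq ι] [Fintype ι] [DecidableEq V]
    (G : SimpleGraph V) (D : ι → Finset V) (v : V) :
    ∑ c, bonferroniCoef c * avoidInd G (starPairs v (bonferroniSet D c)) =
      1 + (∑ a, avoidInd G (starPairs v (D a))) ^ 2 / 2 -
        3 / 2 * ∑ a, avoidInd G (starPairs v (D a)) := by
  rw [sum_bonferroniCoef_mul, add_sub_assoc,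
    ← sum_ite_mul_mul_eq _ fun a => avoidInd_eq_zero_or_one _ _]
  simp only [bonferroniSet, starPairs_union, avoidInd_union]
  simp [avoidInd, starPairs]

lemma sum_bonferroniCoef_mul_avoidInd_nonneg {ι V : Type*} [DecidableEq ι] [Fintype ι]
    [DecidableEq V] (G : SimpleGraph V) (D : ι → Finset V) (v : V) :
    0 ≤ ∑ c, bonferroniCoef c * avoidInd G (starPairs v (bonferroniSet D c)) := by
  rw [sum_bonferroniCoef_mul_avoidInd]
  obtain ⟨t, ht⟩ : ∃ t : ℕ, ∑ a, avoidInd G (starPairs v (D a)) = t := by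
    have : ∀ a, ∃ t : ℕ, avoidInd G (starPairs v (D a)) = t := fun a => by
      rcases avoidInd_eq_zero_or_one G (starPairs v (D a)) with h | h
      · exact ⟨0, by simp [h]⟩
      · exact ⟨1, by simp [h]⟩
    choose t ht using this
    exact ⟨∑ a, t a, by simp [ht]⟩
  rw [ht]
  have h : (0 : ℝ) ≤ (t - 1) * (t - 2) := by
    rcases Nat.lt_or_ge t 2 with h | h
    · interval_cases t <;> norm_num
    · have : (2 : ℝ) ≤ t := by exact_mod_cast h
      nlinarith
  nlinarith

lemma sum_gnpWeight_ite_le {n : ℕ} {p : ℝ} (h0 : 0 ≤ p) (h1 : p ≤ 1) {ι : Type*} [Fintype ι]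
    [DecidableEq ι] (D : ι → Finset (Fin n)) (O : Finset (Fin n)) (hD : ∀ a, Disjoint (D a) O)
    (F : Finset (Sym2 (Fin n))) (hF : ∀ e ∈ F, ¬ e.IsDiag) (hFO : ∀ e ∈ F, ∀ v ∈ O, v ∉ e)
    (Ev : SimpleGraph (Fin n) → Prop) [DecidablePred Ev] (hEF : ∀ G, Ev G → ∀ e ∈ F, e ∉ G.edgeSet)
    (hED : ∀ G, Ev G → ∀ v ∈ O, ∀ a, ∃ u ∈ D a, G.Adj v u) :
    ∑ G, gnpWeight n p G * (if Ev G then 1 else 0) ≤ (1 - p) ^ F.card *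
      (1 + ∑ a, ∑ b, (if a = b then -1 else 1 / 2 : ℝ) * (1 - p) ^ (D a ∪ D b).card)
        ^ O.card := by
  have h := sum_gnpWeight_mul_prod_star p bonferroniCoef (bonferroniSet D) O
    (by
      rintro (_ | ⟨a, b⟩)
      · exact Finset.disjoint_empty_left _
      · exact Finset.disjoint_union_left.2 ⟨hD a, hD b⟩) F hF hFO
  rw [sum_bonferroniCoef_mul] at h
  have hsome : ∀ a b, bonferroniSet D (some (a, b)) = D a ∪ D b := fun _ _ => rfl
  have hnone : bonferroniSet D none = ∅ := rfl
  simp only [hsome, hnone, Finset.card_empty, pow_zero] at h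
  rw [← h]
  refine Finset.sum_le_sum fun G _ => mul_le_mul_of_nonneg_left ?_ (gnpWeight_nonneg h0 h1 G)
  split_ifs with hE
  · refine le_of_eq ?_
    rw [avoidInd, if_pos (hEF G hE), one_mul, eq_comm]
    refine Finset.prod_eq_one fun v hv => ?_
    have : ∀ a, avoidInd G (starPairs v (D a)) = 0 := fun a =>
      avoidInd_starPairs_eq_zero (hED G hE v hv a)
    rw [sum_bonferroniCoef_mul_avoidInd]
    simp [this]
  · exact mul_nonneg (avoidInd_nonneg _ _) (Finset.prod_nonneg fun v _ =>
      sum_bonferroniCoef_mul_avoidInd_nonneg G D v)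

/-- The pairs of indices `i < j`. -/
def ltPairs : Finset (Fin 3 × Fin 3) := Finset.univ.filter fun x => x.1 < x.2

/-- The pairs of indices `i ≠ j`. -/
def nePairs : Finset (Fin 3 × Fin 3) := Finset.univ.filter fun x => x.1 ≠ x.2

def crossPairs {V : Type*} [DecidableEq V] (A : Fin 3 → Finset V) : Finset (Sym2 V) :=
  ltPairs.biUnion fun x => (A x.1 ×ˢ A x.2).image fun y => s(y.1, y.2)

def specialPairs {V : Type*} [DecidableEq V] (a : Fin 3 → V) : Finset (Sym2 V) :=
  ltPairs.image fun x => s(a x.1, a x.2)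

lemma card_specialPairs_le {V : Type*} [DecidableEq V] (a : Fin 3 → V) :
    (specialPairs a).card ≤ 3 := Finset.card_image_le.trans (by decide)

lemma mem_crossPairs {V : Type*} [DecidableEq V] {A : Fin 3 → Finset V} {e : Sym2 V} :
    e ∈ crossPairs A ↔ ∃ i j, i < j ∧ ∃ u ∈ A i, ∃ v ∈ A j, e = s(u, v) := by
  simp only [crossPairs, ltPairs, Finset.mem_biUnion, Finset.mem_filter, Finset.mem_univ,
    true_and, Finset.mem_image, Finset.mem_product, Prod.exists]
  constructor
  · rintro ⟨i, j, hij, u, v, ⟨hu, hv⟩, rfl⟩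
    exact ⟨i, j, hij, u, hu, v, hv, rfl⟩
  · rintro ⟨i, j, hij, u, hu, v, hv, rfl⟩
    exact ⟨i, j, hij, u, v, ⟨hu, hv⟩, rfl⟩

lemma eq_of_mem_of_mem {V : Type*} {A : Fin 3 → Finset V}
    (hA : Pairwise fun i j => Disjoint (A i) (A j)) {i j : Fin 3} {v : V} (hi : v ∈ A i)
    (hj : v ∈ A j) : i = j :=
  not_not.1 fun h => Finset.disjoint_left.1 (hA h) hi hj

lemma card_crossPairs {V : Type*} [DecidableEq V] {A : Fin 3 → Finset V}
    (hA : Pairwise fun i j => Disjoint (A i) (A j)) {k : ℕ} (hk : ∀ i, (A i).card = k) :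
    (crossPairs A).card = 3 * k ^ 2 := by
  rw [crossPairs, Finset.card_biUnion]
  · have : ∀ x ∈ ltPairs, ((A x.1 ×ˢ A x.2).image fun y => s(y.1, y.2)).card = k ^ 2 := by
      rintro ⟨i, j⟩ hx
      simp only [ltPairs, Finset.mem_filter, Finset.mem_univ, true_and] at hx
      rw [Finset.card_image_of_injOn, Finset.card_product, hk, hk, sq]
      rintro ⟨u, v⟩ hu ⟨u', v'⟩ hu' h
      simp only [Finset.coe_product, Set.mem_prod, Finset.mem_coe] at hu hu'
      rcases Sym2.eq_iff.1 h with h | h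
      · exact Prod.ext h.1 h.2
      · exact absurd (eq_of_mem_of_mem hA hu.1 (by
          have h1 : u = v' := h.1
          exact h1 ▸ hu'.2)) hx.ne
    rw [Finset.sum_congr rfl this, Finset.sum_const, smul_eq_mul]
    congr 1
  · rintro ⟨i, j⟩ hx ⟨i', j'⟩ hx' hne
    simp only [ltPairs, Finset.coe_filter, Finset.mem_univ, true_and, Set.mem_ofPred_eq] at hx hx'
    rw [Function.onFun, Finset.disjoint_left]
    intro e he he'
    simp only [Finset.mem_image, Finset.mem_product, Prod.exists] at he he'
    obtain ⟨u, v, ⟨hu, hv⟩, rfl⟩ := he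
    obtain ⟨u', v', ⟨hu', hv'⟩, h⟩ := he'
    rcases Sym2.eq_iff.1 h with ⟨rfl, rfl⟩ | ⟨rfl, rfl⟩
    · exact hne (Prod.ext (eq_of_mem_of_mem hA hu hu') (eq_of_mem_of_mem hA hv hv'))
    · have h1 := eq_of_mem_of_mem hA hu hv'
      have h2 := eq_of_mem_of_mem hA hv hu'
      omega

def overlap (r : Fin 3 → Fin 3 → ℕ) : ℕ :=
  ∑ x ∈ ltPairs, ∑ y ∈ nePairs, r x.1 y.1 * r x.2 y.2

lemma card_crossPairs_inter_le {V : Type*} [DecidableEq V] (A B : Fin 3 → Finset V) :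
    (crossPairs A ∩ crossPairs B).card ≤ overlap fun i j => (A i ∩ B j).card := by
  have hsub : crossPairs A ∩ crossPairs B ⊆ ltPairs.biUnion fun x => nePairs.biUnion fun y =>
      ((A x.1 ∩ B y.1) ×ˢ (A x.2 ∩ B y.2)).image fun z => s(z.1, z.2) := by
    intro e he
    obtain ⟨h1, h2⟩ := Finset.mem_inter.1 he
    obtain ⟨i, j, hij, u, hu, v, hv, rfl⟩ := mem_crossPairs.1 h1
    obtain ⟨i', j', hij', u', hu', v', hv', h⟩ := mem_crossPairs.1 h2
    simp only [ltPairs, nePairs, Finset.mem_biUnion, Finset.mem_filter, Finset.mem_univ,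
      true_and, Finset.mem_image, Finset.mem_product, Finset.mem_inter, Prod.exists]
    rcases Sym2.eq_iff.1 h with ⟨rfl, rfl⟩ | ⟨rfl, rfl⟩
    · exact ⟨i, j, hij, i', j', hij'.ne, u, v, ⟨⟨hu, hu'⟩, hv, hv'⟩, rfl⟩
    · exact ⟨i, j, hij, j', i', hij'.ne', u, v, ⟨⟨hu, hv'⟩, hv, hu'⟩, rfl⟩
  refine (Finset.card_le_card hsub).trans (Finset.card_biUnion_le.trans ?_)
  refine Finset.sum_le_sum fun x _ => Finset.card_biUnion_le.trans ?_
  refine Finset.sum_le_sum fun y _ => Finset.card_image_le.trans ?_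
  rw [Finset.card_product]

/-- `SpecialTuple` for indexed families, without the disjointness and membership conditions. -/
def IsSpecialFamily {V : Type*} (G : SimpleGraph V) (A : Fin 3 → Finset V) (a : Fin 3 → V) :
    Prop :=
  (∀ v, (∀ i, v ∉ A i) → ∀ i, ∃ u ∈ A i, G.Adj v u) ∧
  ∀ i j, i < j → ∀ u ∈ A i, ∀ v ∈ A j, (G.Adj u v ↔ u = a i ∧ v = a j)

lemma IsSpecialFamily.notMem_edgeSet {V : Type*} [DecidableEq V] {G : SimpleGraph V}
    {A : Fin 3 → Finset V} {a : Fin 3 → V} (h : IsSpecialFamily G A a) {e : Sym2 V}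
    (he : e ∈ crossPairs A) (hs : e ∉ specialPairs a) : e ∉ G.edgeSet := by
  obtain ⟨i, j, hij, u, hu, v, hv, rfl⟩ := mem_crossPairs.1 he
  intro hG
  obtain ⟨rfl, rfl⟩ := (h.2 i j hij u hu v hv).1 hG
  exact hs (Finset.mem_image.2 ⟨(i, j), by simp [ltPairs, hij], rfl⟩)

open Classical in
lemma sum_gnpWeight_two_families_le {n : ℕ} {p : ℝ} (h0 : 0 < p) (h1 : p < 1) {k : ℕ}
    {A B : Fin 3 → Finset (Fin n)} (a b : Fin 3 → Fin n)
    (hA : Pairwise fun i j => Disjoint (A i) (A j)) (hAk : ∀ i, (A i).card = k)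
    (hB : Pairwise fun i j => Disjoint (B i) (B j)) (hBk : ∀ i, (B i).card = k)
    (hk : 6 * (1 - p) ^ k ≤ 1) :
    ∃ m ≤ n, n ≤ m + 6 * k ∧
    ∑ G, gnpWeight n p G * (if IsSpecialFamily G A a ∧ IsSpecialFamily G B b then 1 else 0) ≤
      (1 - p) ^ (6 * k ^ 2) / (1 - p) ^ (overlap (fun i j => (A i ∩ B j).card) + 6) *
      (1 - 6 * (1 - p) ^ k + 6 * (1 - p) ^ (2 * k) +
        ∑ i, ∑ j, (1 - p) ^ (2 * k - (A i ∩ B j).card)) ^ m := by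
  set D : Fin 3 ⊕ Fin 3 → Finset (Fin n) := Sum.elim A B with hD
  set W : Finset (Fin n) := Finset.univ.biUnion D with hW
  set F := (crossPairs A ∪ crossPairs B) \ (specialPairs a ∪ specialPairs b) with hF
  have hAW : ∀ i, A i ⊆ W := fun i =>
    Finset.subset_biUnion_of_mem D (Finset.mem_univ (Sum.inl i))
  have hBW : ∀ i, B i ⊆ W := fun i =>
    Finset.subset_biUnion_of_mem D (Finset.mem_univ (Sum.inr i))
  have hWk : W.card ≤ 6 * k := by
    refine Finset.card_biUnion_le.trans (le_of_eq ?_)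
    simp [hD, hAk, hBk]
    ring
  have hFW : ∀ e ∈ F, ∃ u ∈ W, ∃ v ∈ W, u ≠ v ∧ e = s(u, v) := by
    intro e he
    rcases Finset.mem_union.1 (Finset.mem_sdiff.1 he).1 with he | he
    · obtain ⟨i, j, hij, u, hu, v, hv, rfl⟩ := mem_crossPairs.1 he
      refine ⟨u, hAW i hu, v, hAW j hv, ?_, rfl⟩
      rintro rfl
      exact hij.ne (eq_of_mem_of_mem hA hu hv)
    · obtain ⟨i, j, hij, u, hu, v, hv, rfl⟩ := mem_crossPairs.1 he
      refine ⟨u, hBW i hu, v, hBW j hv, ?_, rfl⟩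
      rintro rfl
      exact hij.ne (eq_of_mem_of_mem hB hu hv)
  have key := sum_gnpWeight_ite_le h0.le h1.le D Wᶜ
    (fun x => disjoint_compl_right.mono_left
      (Finset.subset_biUnion_of_mem D (Finset.mem_univ x))) F
    (by
      intro e he
      obtain ⟨u, hu, v, hv, huv, rfl⟩ := hFW e he
      simpa using huv)
    (by
      intro e he w hw
      obtain ⟨u, hu, v, hv, huv, rfl⟩ := hFW e he
      rw [Finset.mem_compl] at hw
      rw [Sym2.mem_iff, not_or]
      exact ⟨fun h => hw (h ▸ hu), fun h => hw (h ▸ hv)⟩)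
    (fun G => IsSpecialFamily G A a ∧ IsSpecialFamily G B b)
    (by
      rintro G ⟨hGA, hGB⟩ e he
      obtain ⟨he1, he2⟩ := Finset.mem_sdiff.1 he
      rw [Finset.mem_union, not_or] at he2
      rcases Finset.mem_union.1 he1 with he1 | he1
      · exact hGA.notMem_edgeSet he1 he2.1
      · exact hGB.notMem_edgeSet he1 he2.2)
    (by
      rintro G ⟨hGA, hGB⟩ v hv x
      rw [Finset.mem_compl] at hv
      rcases x with i | i
      · exact hGA.1 v (fun i h => hv (hAW i h)) i
      · exact hGB.1 v (fun i h => hv (hBW i h)) i)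
  have hm := Finset.card_compl_add_card W
  rw [Fintype.card_fin] at hm
  refine ⟨Wᶜ.card, by omega, by omega, ?_⟩
  have hq : 0 < 1 - p := sub_pos.2 h1
  have hbase : 1 + ∑ x, ∑ y, (if x = y then -1 else 1 / 2 : ℝ) * (1 - p) ^ (D x ∪ D y).card
      = 1 - 6 * (1 - p) ^ k + 6 * (1 - p) ^ (2 * k) +
        ∑ i, ∑ j, (1 - p) ^ (2 * k - (A i ∩ B j).card) := by
    have hAB : ∀ i j, (A i ∪ B j).card = 2 * k - (A i ∩ B j).card := fun i j => by
      rw [Finset.card_union, hAk, hBk, two_mul]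
    have hBA : ∀ i j, (B i ∪ A j).card = 2 * k - (A j ∩ B i).card := fun i j => by
      rw [Finset.union_comm, hAB]
    have hAA : ∀ i j, i ≠ j → (A i ∪ A j).card = 2 * k := fun i j h => by
      rw [Finset.card_union_of_disjoint (hA h), hAk, hAk, two_mul]
    have hBB : ∀ i j, i ≠ j → (B i ∪ B j).card = 2 * k := fun i j h => by
      rw [Finset.card_union_of_disjoint (hB h), hBk, hBk, two_mul]
    have hs : ∀ E : Fin 3 → Finset (Fin n), (∀ i, (E i).card = k) →
        (∀ i j, i ≠ j → (E i ∪ E j).card = 2 * k) →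
        ∑ i, ∑ j, (if i = j then -1 else 1 / 2 : ℝ) * (1 - p) ^ (E i ∪ E j).card
        = -3 * (1 - p) ^ k + 3 * (1 - p) ^ (2 * k) := by
      intro E h1 h2
      simp only [Fin.sum_univ_three]
      simp [h1, h2]
      ring
    rw [Fintype.sum_sum_type]
    simp only [Fintype.sum_sum_type, hD, Sum.elim_inl, Sum.elim_inr, Sum.inl.injEq,
      Sum.inr.injEq, reduceCtorEq, if_false, Finset.sum_add_distrib, hs A hAk hAA,
      hs B hBk hBB, hAB, hBA, ← Finset.mul_sum]
    rw [Finset.sum_comm (f := fun i j => (1 - p) ^ (2 * k - (A j ∩ B i).card))]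
    ring
  rw [hbase] at key
  have hbase0 : 0 ≤ 1 - 6 * (1 - p) ^ k + 6 * (1 - p) ^ (2 * k) +
        ∑ i, ∑ j, (1 - p) ^ (2 * k - (A i ∩ B j).card) := by
    have h2 : 0 ≤ 6 * (1 - p) ^ (2 * k) := by positivity
    have h3 : 0 ≤ ∑ i, ∑ j, (1 - p) ^ (2 * k - (A i ∩ B j).card) :=
      Finset.sum_nonneg fun i _ => Finset.sum_nonneg fun j _ => pow_nonneg hq.le _
    linarith
  refine key.trans (mul_le_mul_of_nonneg_right ?_ (pow_nonneg hbase0 _))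
  rw [le_div_iff₀ (pow_pos hq _), ← pow_add]
  refine pow_le_pow_of_le_one hq.le (by linarith) ?_
  have c1 := Finset.card_union_add_card_inter (crossPairs A) (crossPairs B)
  rw [card_crossPairs hA hAk, card_crossPairs hB hBk] at c1
  have c2 := card_crossPairs_inter_le A B
  have c3 := Finset.le_card_sdiff (specialPairs a ∪ specialPairs b) (crossPairs A ∪ crossPairs B)
  have c4 := Finset.card_union_le (specialPairs a) (specialPairs b)
  have c5 := card_specialPairs_le a
  have c6 := card_specialPairs_le b
  rw [← hF] at c3
  omega

lemma card_filter_card_inter_eq_le {V : Type*} [Fintype V] [DecidableEq V] {A : Fin 3 → Finset V}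
    (hA : Pairwise fun i j => Disjoint (A i) (A j)) {k : ℕ} (hAk : ∀ i, (A i).card = k)
    (r : Fin 3 → ℕ) :
    (Finset.univ.filter fun B : Finset V => B.card = k ∧ ∀ i, (A i ∩ B).card = r i).card ≤
      (∏ i, k.choose (r i)) * (Fintype.card V).choose (k - ∑ i, r i) := by
  have hcard : ((Fintype.piFinset fun i => (A i).powersetCard (r i)) ×ˢ
      (Finset.univ : Finset V).powersetCard (k - ∑ i, r i)).card =
      (∏ i, k.choose (r i)) * (Fintype.card V).choose (k - ∑ i, r i) := by
    rw [Finset.card_product, Fintype.card_piFinset, Finset.card_powersetCard, Finset.card_univ]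
    simp [Finset.card_powersetCard, hAk]
  rw [← hcard]
  have hunion : ∀ B : Finset V, (Finset.univ.biUnion fun i => A i ∩ B) ∪
      B \ (Finset.univ.biUnion fun i => A i ∩ B) = B := fun B =>
    Finset.union_sdiff_of_subset (Finset.biUnion_subset.2 fun i _ => Finset.inter_subset_right)
  refine Finset.card_le_card_of_injOn
    (fun B => (fun i => A i ∩ B, B \ (Finset.univ.biUnion fun i => A i ∩ B))) ?_ ?_
  · intro B hB
    simp only [Finset.coe_filter, Finset.mem_univ, true_and, Set.mem_ofPred_eq] at hB
    simp only [Finset.mem_coe, Finset.mem_product, Fintype.mem_piFinset,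
      Finset.mem_powersetCard]
    refine ⟨fun i => ⟨Finset.inter_subset_left, hB.2 i⟩, Finset.subset_univ _, ?_⟩
    rw [Finset.card_sdiff_of_subset
      (Finset.biUnion_subset.2 fun i _ => Finset.inter_subset_right), hB.1, Finset.card_biUnion]
    · simp [hB.2]
    · intro i _ j _ hij
      exact (hA hij).mono Finset.inter_subset_left Finset.inter_subset_left
  · intro B _ B' _ h
    obtain ⟨h1, h2⟩ := Prod.ext_iff.1 h
    simp only [funext_iff] at h1 h2
    rw [← hunion B, ← hunion B', h2]
    simp only [h1]

lemma card_filter_card_inter_families_le {V : Type*} [Fintype V] [DecidableEq V]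
    {A : Fin 3 → Finset V} (hA : Pairwise fun i j => Disjoint (A i) (A j)) {k : ℕ}
    (hAk : ∀ i, (A i).card = k) (r : Fin 3 → Fin 3 → ℕ) :
    (Finset.univ.filter fun B : Fin 3 → Finset V =>
      (∀ j, (B j).card = k) ∧ (fun i j => (A i ∩ B j).card) = r).card ≤
      ∏ j, ((∏ i, k.choose (r i j)) * (Fintype.card V).choose (k - ∑ i, r i j)) := by
  refine le_trans (Finset.card_le_card (t := Fintype.piFinset fun j =>
    Finset.univ.filter fun B : Finset V => B.card = k ∧ ∀ i, (A i ∩ B).card = r i j) ?_) ?_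
  · intro B hB
    simp only [Finset.mem_filter, Finset.mem_univ, true_and, Fintype.mem_piFinset] at hB ⊢
    exact fun j => ⟨hB.1 j, fun i => congrFun (congrFun hB.2 i) j⟩
  · rw [Fintype.card_piFinset]
    exact Finset.prod_le_prod' fun j _ => card_filter_card_inter_eq_le hA hAk fun i => r i j

lemma overlap_eq (r : Fin 3 → Fin 3 → ℕ) :
    overlap r =
      r 0 0 * r 1 1 + r 0 0 * r 1 2 + r 0 1 * r 1 0 + r 0 1 * r 1 2 + r 0 2 * r 1 0
        + r 0 2 * r 1 1
      + (r 0 0 * r 2 1 + r 0 0 * r 2 2 + r 0 1 * r 2 0 + r 0 1 * r 2 2 + r 0 2 * r 2 0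
        + r 0 2 * r 2 1)
      + (r 1 0 * r 2 1 + r 1 0 * r 2 2 + r 1 1 * r 2 0 + r 1 1 * r 2 2 + r 1 2 * r 2 0
        + r 1 2 * r 2 1) := by
  simp [overlap, ltPairs, nePairs, Finset.sum_filter, Fintype.sum_prod_type, Fin.sum_univ_three]
  ring

lemma exists_add_overlap_eq {k : ℕ} {r : Fin 3 → Fin 3 → ℕ} (hrow : ∀ i, ∑ j, r i j ≤ k)
    (hcol : ∀ j, ∑ i, r i j ≤ k) :
    ∃ f : ℕ, k * ∑ j, ∑ i, r i j = overlap r + f ∧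
      (∀ j j', j ≠ j' → (∑ i, r i j) * (k - ∑ i, r i j') ≤ 2 * f) ∧
      (∀ j i i', i ≠ i' → r i j * r i' j ≤ f) ∧
      ((∀ j, 2 * ∑ i, r i j ≤ k) → k * ∑ j, ∑ i, r i j ≤ 2 * f) := by
  have hrow' : ∀ i, r i 0 + r i 1 + r i 2 ≤ k := fun i => by
    have := hrow i; rwa [Fin.sum_univ_three] at this
  have hcol' : ∀ j, r 0 j + r 1 j + r 2 j ≤ k := fun j => by
    have := hcol j; rwa [Fin.sum_univ_three] at this
  simp only [Fin.sum_univ_three, overlap_eq]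
  have hd : ∀ j, ∃ d, r 0 j + r 1 j + r 2 j + d = k := fun j =>
    (Nat.exists_eq_add_of_le (hcol' j)).imp fun _ h => h.symm
  have he : ∀ i, ∃ e, r i 0 + r i 1 + r i 2 + e = k := fun i =>
    (Nat.exists_eq_add_of_le (hrow' i)).imp fun _ h => h.symm
  choose d hd using hd
  choose e he using he
  obtain ⟨S, hS⟩ : ∃ S, S = k * (r 0 0 + r 1 0 + r 2 0 + (r 0 1 + r 1 1 + r 2 1)
    + (r 0 2 + r 1 2 + r 2 2)) := ⟨_, rfl⟩
  obtain ⟨v, hv⟩ : ∃ v, v = r 0 0 * r 1 1 + r 0 0 * r 1 2 + r 0 1 * r 1 0 + r 0 1 * r 1 2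
    + r 0 2 * r 1 0 + r 0 2 * r 1 1
    + (r 0 0 * r 2 1 + r 0 0 * r 2 2 + r 0 1 * r 2 0 + r 0 1 * r 2 2 + r 0 2 * r 2 0
    + r 0 2 * r 2 1)
    + (r 1 0 * r 2 1 + r 1 0 * r 2 2 + r 1 1 * r 2 0 + r 1 1 * r 2 2 + r 1 2 * r 2 0
    + r 1 2 * r 2 1) := ⟨_, rfl⟩
  obtain ⟨c, hc⟩ : ∃ c : Fin 3 → ℕ, ∀ j, c j = r 0 j + r 1 j + r 2 j := ⟨_, fun _ => rfl⟩
  have hsub : ∀ j, k - c j = d j := fun j => by have := hd j; have := hc j; omega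
  rw [← hS, ← hv]
  simp only [← hc, hsub]
  have h1 : 2 * S = 2 * v + (c 0 * d 1 + c 0 * d 2 + (c 1 * d 0 + c 1 * d 2)
      + (c 2 * d 0 + c 2 * d 1) + 2 * (r 0 0 * r 0 1 + r 0 0 * r 0 2 + r 0 1 * r 0 2
      + (r 1 0 * r 1 1 + r 1 0 * r 1 2 + r 1 1 * r 1 2)
      + (r 2 0 * r 2 1 + r 2 0 * r 2 2 + r 2 1 * r 2 2))) := by
    rw [hS, hv]
    simp only [hc]
    have h0 := hd 0
    have h1 := hd 1
    have h2 := hd 2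
    zify at h0 h1 h2 ⊢
    linear_combination -(r 0 0 + r 1 0 + r 2 0 : ℤ) * (h1 + h2)
      - (r 0 1 + r 1 1 + r 2 1 : ℤ) * (h0 + h2) - (r 0 2 + r 1 2 + r 2 2 : ℤ) * (h0 + h1)
  have h2 : 2 * S = 2 * v + ((r 0 0 + r 0 1 + r 0 2) * (e 1 + e 2)
      + (r 1 0 + r 1 1 + r 1 2) * (e 0 + e 2) + (r 2 0 + r 2 1 + r 2 2) * (e 0 + e 1)
      + 2 * (r 0 0 * r 1 0 + r 0 0 * r 2 0 + r 1 0 * r 2 0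
      + (r 0 1 * r 1 1 + r 0 1 * r 2 1 + r 1 1 * r 2 1)
      + (r 0 2 * r 1 2 + r 0 2 * r 2 2 + r 1 2 * r 2 2))) := by
    rw [hS, hv]
    have h0 := he 0
    have h1 := he 1
    have h2 := he 2
    zify at h0 h1 h2 ⊢
    linear_combination -(r 0 0 + r 0 1 + r 0 2 : ℤ) * (h1 + h2)
      - (r 1 0 + r 1 1 + r 1 2 : ℤ) * (h0 + h2) - (r 2 0 + r 2 1 + r 2 2 : ℤ) * (h0 + h1)
  obtain ⟨f, hf⟩ : ∃ f, S = v + f := Nat.exists_eq_add_of_le (by omega)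
  refine ⟨f, hf, ?_, ?_, ?_⟩
  · intro j j' hjj
    fin_cases j <;> fin_cases j' <;> first | exact absurd rfl hjj | (dsimp; omega)
  · intro j i i' hii
    have h3 := Nat.mul_comm (r 0 j) (r 1 j)
    have h4 := Nat.mul_comm (r 0 j) (r 2 j)
    have h5 := Nat.mul_comm (r 1 j) (r 2 j)
    fin_cases j <;> fin_cases i <;> fin_cases i' <;>
      first | exact absurd rfl hii | (dsimp at h3 h4 h5 ⊢; omega)
  · intro h
    have hle : ∀ j j', k ≤ d j + d j' := fun j j' => by
      have := h j; have := h j'; have := hc j; have := hc j'; have := hd j; have := hd j'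
      omega
    have m0 := Nat.mul_le_mul_left (c 0) (hle 1 2)
    have m1 := Nat.mul_le_mul_left (c 1) (hle 0 2)
    have m2 := Nat.mul_le_mul_left (c 2) (hle 0 1)
    rw [← hc, ← hc, ← hc] at hS
    nlinarith

/-- Either all entries are at most `b`, or one is at least `k - b` and the others are at
most `b`. -/
def IsExtremeColumn (k b : ℕ) (x : Fin 3 → ℕ) : Prop :=
  (∀ i, x i ≤ b) ∨ ∃ i, k ≤ x i + b ∧ ∀ i', i' ≠ i → x i' ≤ b

lemma isExtremeColumn_of_mul_le {k a : ℕ} {x : Fin 3 → ℕ} (hk : 32 * a ≤ k)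
    (hx : k ≤ ∑ i, x i + 6 * a) (hmul : ∀ i i', i ≠ i' → x i * x i' < a * k) :
    ∃ i, k ≤ x i + 14 * a ∧ ∀ i', i' ≠ i → x i' ≤ 4 * a := by
  obtain ⟨i, -, hi⟩ := Finset.exists_max_image Finset.univ x ⟨0, Finset.mem_univ _⟩
  have hle : ∑ i', x i' ≤ 3 * x i := by
    rw [Fin.sum_univ_three]
    have := hi 0 (Finset.mem_univ _)
    have := hi 1 (Finset.mem_univ _)
    have := hi 2 (Finset.mem_univ _)
    omega
  have hsmall : ∀ i', i' ≠ i → x i' ≤ 4 * a := by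
    intro i' hne
    by_contra! hlt
    have h := hmul i' i hne
    nlinarith
  refine ⟨i, ?_, hsmall⟩
  rw [Fin.sum_univ_three] at hx
  have h0 := hsmall 0
  have h1 := hsmall 1
  have h2 := hsmall 2
  fin_cases i <;> simp at h0 h1 h2 ⊢ <;> omega

lemma extreme_of_lt {k a f : ℕ} {r : Fin 3 → Fin 3 → ℕ} (ha : 1 ≤ a) (hk : 32 * a ≤ k)
    (hcol : ∀ j, ∑ i, r i j ≤ k)
    (h1 : ∀ j j', j ≠ j' → (∑ i, r i j) * (k - ∑ i, r i j') ≤ 2 * f)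
    (h2 : ∀ j i i', i ≠ i' → r i j * r i' j ≤ f)
    (h3 : (∀ j, 2 * ∑ i, r i j ≤ k) → k * ∑ j, ∑ i, r i j ≤ 2 * f) (hf : f < a * k) :
    (∀ j, IsExtremeColumn k (14 * a) fun i => r i j) ∧
      (r = 0 ∨ (∀ j, ∃ i, r i j = k) ∨ k ≤ 4 * f) := by
  by_cases hs : ∀ j, 2 * ∑ i, r i j ≤ k
  · have h := h3 hs
    have hR : ∑ j, ∑ i, r i j ≤ 2 * a := by
      by_contra! hlt
      nlinarith
    have hle : ∀ i j, r i j ≤ ∑ j, ∑ i, r i j := fun i j =>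
      (Finset.single_le_sum (f := fun i => r i j) (fun _ _ => Nat.zero_le _)
        (Finset.mem_univ i)).trans
        (Finset.single_le_sum (f := fun j => ∑ i, r i j) (fun _ _ => Nat.zero_le _)
          (Finset.mem_univ j))
    refine ⟨fun j => Or.inl fun i => (hle i j).trans (by omega), ?_⟩
    rcases Nat.eq_zero_or_pos (∑ j, ∑ i, r i j) with h0 | h0
    · left
      funext i j
      exact Nat.le_zero.1 (h0 ▸ hle i j)
    · right; right
      nlinarith
  · push Not at hs
    obtain ⟨j₀, hj₀⟩ := hs
    have hbig : ∀ j, k / 2 ≤ ∑ i, r i j → ∀ j', j ≠ j' → k ≤ ∑ i, r i j' + 6 * a := by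
      intro j hj j' hne
      by_contra! hlt
      have h := h1 j j' hne
      have h6 : 6 * a ≤ k - ∑ i, r i j' := by omega
      have := Nat.mul_le_mul hj h6
      have h7 : k ≤ 2 * (k / 2) + 1 := by omega
      nlinarith
    have hj : ∀ j, k ≤ ∑ i, r i j + 6 * a := by
      obtain ⟨j₁, hj₁⟩ := exists_ne j₀
      have hb := hbig j₀ (by omega) j₁ hj₁.symm
      intro j
      by_cases h : j = j₀
      · subst h
        exact hbig j₁ (by omega) j hj₁
      · exact hbig j₀ (by omega) j (Ne.symm h)
    have hex : ∀ j, ∃ i, k ≤ r i j + 14 * a ∧ ∀ i', i' ≠ i → r i' j ≤ 4 * a := fun j =>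
      isExtremeColumn_of_mul_le (x := fun i => r i j) hk (hj j)
        fun i i' h => (h2 j i i' h).trans_lt hf
    refine ⟨fun j => Or.inr ?_, ?_⟩
    · obtain ⟨i, hi, hi'⟩ := hex j
      exact ⟨i, hi, fun i' h => (hi' i' h).trans (by omega)⟩
    · right
      by_contra! hcon
      obtain ⟨⟨j, hjk⟩, hkf⟩ := hcon
      have hfull : ∑ i, r i j = k := by
        by_contra hne
        have hlt : 1 ≤ k - ∑ i, r i j := by have := hcol j; omega
        obtain ⟨j', hj'⟩ := exists_ne j
        have h := h1 j' j hj'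
        have := Nat.mul_le_mul_left (∑ i, r i j') hlt
        have := hj j'
        omega
      obtain ⟨i, hi, hi'⟩ := hex j
      have hother : ∃ i', i' ≠ i ∧ 1 ≤ r i' j := by
        by_contra! hno
        refine hjk i ?_
        rw [← hfull, eq_comm]
        exact Finset.sum_eq_single i (fun i' _ h => by have := hno i' h; omega) (by simp)
      obtain ⟨i', hne, hpos⟩ := hother
      have h := h2 j i' i hne
      nlinarith

lemma eventually_mul_pow_mul_pow_le_one (C : ℝ) (d : ℕ) {s : ℝ} (h0 : 0 ≤ s) (h1 : s < 1) :
    ∀ᶠ k : ℕ in atTop, C * (k : ℝ) ^ d * s ^ k ≤ 1 := by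
  have h := (tendsto_pow_const_mul_const_pow_of_lt_one d h0 h1).const_mul C
  rw [mul_zero] at h
  filter_upwards [h.eventually_le_const one_pos] with k hk
  rwa [mul_assoc]

lemma choose_cast_le_pow_of_le {k b x : ℕ} (hk : 1 ≤ k) (hx : x ≤ b) :
    (k.choose x : ℝ) ≤ (k : ℝ) ^ b := by
  exact_mod_cast (Nat.choose_le_pow k x).trans (Nat.pow_le_pow_right hk hx)

lemma choose_cast_le_pow_of_le_add {k b x : ℕ} (hk : 1 ≤ k) (hxk : x ≤ k) (hx : k ≤ x + b) :
    (k.choose x : ℝ) ≤ (k : ℝ) ^ b := by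
  rw [← Nat.choose_symm hxk]
  exact choose_cast_le_pow_of_le hk (by omega)

/-- The contribution of one column of an intersection matrix to the normalised second moment. -/
noncomputable def columnTerm (q : ℝ) (k : ℕ) (x : Fin 3 → ℕ) : ℝ :=
  (∏ i, (k.choose (x i) : ℝ)) * ((k : ℝ) ^ (k - ∑ i, x i) / (k - ∑ i, x i).factorial) *
    exp (-k) * exp (∑ i, k * q ^ (k - x i))

lemma columnTerm_nonneg (q : ℝ) (k : ℕ) (x : Fin 3 → ℕ) : 0 ≤ columnTerm q k x := by
  unfold columnTerm
  positivity

lemma columnTerm_le {q : ℝ} (h0 : 0 ≤ q) (h1 : q ≤ 1) (k : ℕ) (x : Fin 3 → ℕ) :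
    columnTerm q k x ≤ (8 * exp 3) ^ k := by
  have hchoose : ∏ i, (k.choose (x i) : ℝ) ≤ ∏ _i : Fin 3, (2 : ℝ) ^ k :=
    Finset.prod_le_prod (fun _ _ => by positivity)
      fun i _ => by exact_mod_cast Nat.choose_le_two_pow k (x i)
  have hexp : ∑ i, k * q ^ (k - x i) ≤ ∑ _i : Fin 3, (k : ℝ) :=
    Finset.sum_le_sum fun i _ => mul_le_of_le_one_right (by positivity) (pow_le_one₀ h0 h1)
  have hfac := Real.pow_div_factorial_le_exp (x := (k : ℝ)) (by positivity) (k - ∑ i, x i)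
  calc columnTerm q k x
      ≤ (∏ _i : Fin 3, (2 : ℝ) ^ k) * exp k * exp (-k) * exp (∑ _i : Fin 3, (k : ℝ)) := by
        unfold columnTerm
        gcongr
    _ = (8 * exp 3) ^ k := by
        rw [mul_assoc (∏ _i : Fin 3, (2 : ℝ) ^ k), ← exp_add, add_neg_cancel, exp_zero, mul_one,
          mul_pow, ← exp_nat_mul]
        simp only [Finset.prod_const, Finset.sum_const, Finset.card_univ, Fintype.card_fin,
          nsmul_eq_mul, ← pow_mul, mul_comm k 3]
        rw [pow_mul]
        norm_num [mul_comm]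

lemma mul_pow_sub_le_one {q : ℝ} (h0 : 0 ≤ q) (h1 : q ≤ 1) {k b x : ℕ}
    (hkb : k * q ^ (k - b) ≤ 1) (hx : x ≤ b) : k * q ^ (k - x) ≤ 1 :=
  le_trans (by gcongr k * ?_; exact pow_le_pow_of_le_one h0 h1 (by omega)) hkb

lemma sum_mul_pow_sub_le {q : ℝ} (h0 : 0 ≤ q) (h1 : q ≤ 1) {k b : ℕ} {x : Fin 3 → ℕ}
    (hkb : k * q ^ (k - b) ≤ 1) {i : Fin 3} (hx : ∀ i', i' ≠ i → x i' ≤ b) :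
    ∑ i, k * q ^ (k - x i) ≤ k + 2 := by
  rw [← Finset.add_sum_erase _ _ (Finset.mem_univ i)]
  refine add_le_add (mul_le_of_le_one_right (by positivity) (pow_le_one₀ h0 h1)) ?_
  refine (Finset.sum_le_card_nsmul _ _ 1 fun i' hi' =>
    mul_pow_sub_le_one h0 h1 hkb (hx i' (Finset.ne_of_mem_erase hi'))).trans ?_
  simp

lemma columnTerm_le_of_isExtremeColumn {q : ℝ} (h0 : 0 ≤ q) (h1 : q ≤ 1) {k b : ℕ}
    {x : Fin 3 → ℕ} (hk : 1 ≤ k) (hkb : k * q ^ (k - b) ≤ 1) (hsum : ∑ i, x i ≤ k)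
    (hx : IsExtremeColumn k b x) : columnTerm q k x ≤ (k : ℝ) ^ (4 * b) * exp 3 := by
  have hk' : (1 : ℝ) ≤ k := by exact_mod_cast hk
  have hxk : ∀ i, x i ≤ k := fun i =>
    (Finset.single_le_sum (fun _ _ => Nat.zero_le _) (Finset.mem_univ i)).trans hsum
  have hchoose : ∏ i, (k.choose (x i) : ℝ) ≤ ∏ _i : Fin 3, (k : ℝ) ^ b := by
    refine Finset.prod_le_prod (fun _ _ => by positivity) fun i _ => ?_
    rcases hx with h | ⟨j, hj, h⟩
    · exact choose_cast_le_pow_of_le hk (h i)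
    · by_cases hij : i = j
      · exact choose_cast_le_pow_of_le_add hk (hxk i) (hij ▸ hj)
      · exact choose_cast_le_pow_of_le hk (h i hij)
  have hpow : ∏ _i : Fin 3, (k : ℝ) ^ b = (k : ℝ) ^ (3 * b) := by
    simp [← pow_mul, mul_comm]
  rw [hpow] at hchoose
  rcases hx with h | ⟨j, hj, h⟩
  · have hexp : ∑ i, k * q ^ (k - x i) ≤ 3 :=
      (Finset.sum_le_card_nsmul _ _ 1 fun i _ => mul_pow_sub_le_one h0 h1 hkb (h i)).trans
        (by simp)
    have hfac := Real.pow_div_factorial_le_exp (x := (k : ℝ)) (by positivity) (k - ∑ i, x i)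
    calc columnTerm q k x ≤ (k : ℝ) ^ (3 * b) * exp k * exp (-k) * exp 3 := by
          unfold columnTerm
          gcongr
      _ = (k : ℝ) ^ (3 * b) * exp 3 := by
          rw [mul_assoc _ (exp k), ← exp_add, add_neg_cancel, exp_zero, mul_one]
      _ ≤ (k : ℝ) ^ (4 * b) * exp 3 := by
          gcongr
          norm_num
  · have hexp := sum_mul_pow_sub_le h0 h1 hkb h
    have hle : x j ≤ ∑ i, x i :=
      Finset.single_le_sum (fun _ _ => Nat.zero_le _) (Finset.mem_univ j)
    have hfac : (k : ℝ) ^ (k - ∑ i, x i) / (k - ∑ i, x i).factorial ≤ (k : ℝ) ^ b :=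
      (div_le_self (by positivity) (by exact_mod_cast (k - ∑ i, x i).factorial_pos)).trans (pow_le_pow_right₀ hk' (by omega))
    calc columnTerm q k x ≤ (k : ℝ) ^ (3 * b) * (k : ℝ) ^ b * exp (-k) * exp (k + 2) := by
          unfold columnTerm
          gcongr
      _ = (k : ℝ) ^ (4 * b) * exp 2 := by
          rw [← pow_add, mul_assoc, ← exp_add]
          congr 2
          · ring
          · ring
      _ ≤ (k : ℝ) ^ (4 * b) * exp 3 := by
          gcongr
          norm_num

lemma eventually_mul_prod_columnTerm_le_one {q : ℝ} (h0 : 0 < q) (h1 : q < 1) :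
    ∀ᶠ k : ℕ in atTop, ∀ (r : Fin 3 → Fin 3 → ℕ) (f : ℕ), (∀ i, ∑ j, r i j ≤ k) →
      (∀ j, ∑ i, r i j ≤ k) → k * ∑ j, ∑ i, r i j = overlap r + f → r ≠ 0 →
      (¬ ∀ j, ∃ i, r i j = k) →
      ((k : ℝ) + 1) ^ 9 * k ^ 3 * ((∏ j, columnTerm q k fun i => r i j) * q ^ f) ≤ 1 := by
  obtain ⟨a, ha, haq⟩ : ∃ a : ℕ, 1 ≤ a ∧ (8 * exp 3) ^ 3 * q ^ a ≤ 1 / 2 := by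
    have h := (tendsto_pow_atTop_nhds_zero_of_lt_one h0.le h1).const_mul ((8 * exp 3) ^ 3)
    rw [mul_zero] at h
    exact ((eventually_ge_atTop 1).and (h.eventually_le_const (by norm_num))).exists
  obtain ⟨s, hs0, hs1, hs⟩ : ∃ s : ℝ, 0 ≤ s ∧ s < 1 ∧ s ^ 4 = q := by
    refine ⟨√√q, by positivity, ?_, ?_⟩
    · rw [Real.sqrt_lt' one_pos, Real.sqrt_lt' (by norm_num)]
      linarith
    · rw [show (4 : ℕ) = 2 * 2 from rfl, pow_mul, Real.sq_sqrt (by positivity),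
        Real.sq_sqrt h0.le]
  have hpoly : ∀ k : ℕ, 1 ≤ k → ((k : ℝ) + 1) ^ 9 * k ^ 3 ≤ 2 ^ 9 * (k : ℝ) ^ 12 := by
    intro k hk
    have hk' : (1 : ℝ) ≤ k := by exact_mod_cast hk
    calc ((k : ℝ) + 1) ^ 9 * k ^ 3 ≤ (2 * (k : ℝ)) ^ 9 * k ^ 3 := by
          gcongr
          linarith
      _ = 2 ^ 9 * (k : ℝ) ^ 12 := by ring
  filter_upwards [eventually_ge_atTop (32 * a),
    eventually_mul_pow_mul_pow_le_one (2 ^ 9) 12 (s := 1 / 2) (by norm_num) (by norm_num),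
    eventually_mul_pow_mul_pow_le_one (2 ^ 9 * exp 3 ^ 3) (12 + 4 * (14 * a) * 3) hs0 hs1,
    eventually_mul_pow_mul_pow_le_one ((q ^ (14 * a))⁻¹) 1 h0.le h1] with k hka hE1 hE2 hE3
  intro r f hrow hcol hf hr hperm
  have hk : 1 ≤ k := by omega
  by_cases hfa : a * k ≤ f
  · have hprod : ∏ j, columnTerm q k (fun i => r i j) ≤ ∏ _j : Fin 3, (8 * exp 3) ^ k :=
      Finset.prod_le_prod (fun _ _ => columnTerm_nonneg _ _ _)
        fun _ _ => columnTerm_le h0.le h1.le _ _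
    calc ((k : ℝ) + 1) ^ 9 * k ^ 3 * ((∏ j, columnTerm q k fun i => r i j) * q ^ f)
        ≤ 2 ^ 9 * (k : ℝ) ^ 12 * ((∏ _j : Fin 3, (8 * exp 3) ^ k) * q ^ (a * k)) := by
          have h0' := Finset.prod_nonneg (s := Finset.univ)
            fun j _ => columnTerm_nonneg q k fun i => r i j
          gcongr ?_ * (?_ * ?_)
          · exact hpoly k hk
          · exact pow_le_pow_of_le_one h0.le h1.le hfa
      _ = 2 ^ 9 * (k : ℝ) ^ 12 * ((8 * exp 3) ^ 3 * q ^ a) ^ k := by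
          rw [Finset.prod_const, Finset.card_univ, Fintype.card_fin, mul_pow _ (q ^ a), ← pow_mul,
            ← pow_mul, ← pow_mul, mul_comm k 3]
      _ ≤ 2 ^ 9 * (k : ℝ) ^ 12 * (1 / 2) ^ k := by gcongr
      _ ≤ 1 := hE1
  · obtain ⟨f', hf', g1, g2, g3⟩ := exists_add_overlap_eq hrow hcol
    obtain rfl : f = f' := by omega
    obtain ⟨hext, hcase⟩ := extreme_of_lt ha hka hcol g1 g2 g3 (by omega)
    have hkf : k ≤ 4 * f := by tauto
    have hkb : k * q ^ (k - 14 * a) ≤ 1 := by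
      rw [pow_sub₀ q h0.ne' (by omega)]
      linarith
    have hprod : ∏ j, columnTerm q k (fun i => r i j) ≤
        ∏ _j : Fin 3, (k : ℝ) ^ (4 * (14 * a)) * exp 3 :=
      Finset.prod_le_prod (fun _ _ => columnTerm_nonneg _ _ _)
        fun j _ => columnTerm_le_of_isExtremeColumn h0.le h1.le hk hkb (hcol j) (hext j)
    calc ((k : ℝ) + 1) ^ 9 * k ^ 3 * ((∏ j, columnTerm q k fun i => r i j) * q ^ f)
        ≤ 2 ^ 9 * (k : ℝ) ^ 12 *
          ((∏ _j : Fin 3, (k : ℝ) ^ (4 * (14 * a)) * exp 3) * s ^ k) := by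
          have h0' := Finset.prod_nonneg (s := Finset.univ)
            fun j _ => columnTerm_nonneg q k fun i => r i j
          gcongr ?_ * (?_ * ?_)
          · exact hpoly k hk
          · rw [← hs, ← pow_mul]
            exact pow_le_pow_of_le_one hs0 hs1.le hkf
      _ = 2 ^ 9 * exp 3 ^ 3 * (k : ℝ) ^ (12 + 4 * (14 * a) * 3) * s ^ k := by
          rw [Finset.prod_const, Finset.card_univ, Fintype.card_fin, mul_pow, ← pow_mul, pow_add]
          ring
      _ ≤ 1 := hE2

lemma pow_div_factorial_mul_exp_neg_le_one (k : ℕ) :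
    (k : ℝ) ^ k / k.factorial * exp (-k) ≤ 1 := by
  rw [exp_neg, ← div_eq_mul_inv, div_le_one (exp_pos _)]
  exact Real.pow_div_factorial_le_exp (k : ℝ) (by positivity) k

lemma pow_div_factorial_mul_exp_neg_pow_six_le (k : ℕ) :
    ((k : ℝ) ^ k / k.factorial * exp (-k)) ^ 6 * k ^ 3 ≤ 1 := by
  have h := Stirling.le_factorial_stirling k
  have hsq : √(k : ℝ) ≤ √(2 * π * k) := by
    apply Real.sqrt_le_sqrt
    have := Real.pi_gt_three
    nlinarith [(Nat.cast_nonneg k : (0 : ℝ) ≤ k)]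
  have hy : (k : ℝ) ^ k / k.factorial * exp (-k) * √k ≤ 1 := by
    have hfac : (0 : ℝ) < k.factorial := by positivity
    rw [div_mul_eq_mul_div, div_mul_eq_mul_div, div_le_one hfac]
    refine le_trans ?_ h
    rw [div_pow, ← exp_nat_mul, mul_one, exp_neg, ← div_eq_mul_inv, mul_comm]
    gcongr
  have hs : (√(k : ℝ)) ^ 2 = k := Real.sq_sqrt (by positivity)
  calc ((k : ℝ) ^ k / k.factorial * exp (-k)) ^ 6 * k ^ 3
      = ((k : ℝ) ^ k / k.factorial * exp (-k) * √k) ^ 6 := by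
        rw [mul_pow _ √(k : ℝ), show (6 : ℕ) = 2 * 3 from rfl, pow_mul √(k : ℝ), hs]
    _ ≤ 1 := pow_le_one₀ (by positivity) hy

lemma columnTerm_zero_le {q : ℝ} {k : ℕ} (hkq : k * q ^ k ≤ 1) :
    columnTerm q k (fun _ => 0) ≤ (k : ℝ) ^ k / k.factorial * exp (-k) * exp 3 := by
  simp only [columnTerm, Nat.choose_zero_right, Nat.cast_one, Finset.prod_const_one, one_mul,
    Finset.sum_const_zero, Nat.sub_zero]
  gcongr
  simp
  linarith

lemma nseq2_mul_pow_le {p : ℝ} (h1 : p < 1) (k : ℕ) :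
    (nseq2 p k : ℝ) * (1 - p) ^ k ≤ k := by
  have hq : 0 < 1 - p := by linarith
  have h := Nat.floor_le (a := (1 / (1 - p)) ^ k * (k : ℝ)) (by positivity)
  calc (nseq2 p k : ℝ) * (1 - p) ^ k ≤ ((1 / (1 - p)) ^ k * (k : ℝ)) * (1 - p) ^ k := by
        gcongr
        exact h
    _ = k := by
        rw [one_div, inv_pow]
        field_simp

lemma le_nseq2_add_one_mul_pow {p : ℝ} (h1 : p < 1) (k : ℕ) :
    (k : ℝ) ≤ (nseq2 p k + 1) * (1 - p) ^ k := by
  have hq : 0 < 1 - p := by linarith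
  have h := (Nat.lt_floor_add_one ((1 / (1 - p)) ^ k * (k : ℝ))).le
  calc (k : ℝ) = ((1 / (1 - p)) ^ k * (k : ℝ)) * (1 - p) ^ k := by
        rw [one_div, inv_pow]
        field_simp
    _ ≤ _ := by
        gcongr
        exact h

lemma bonferroni_pow_le {q : ℝ} (h0 : 0 < q) (h1 : q < 1) {n m k : ℕ} (hmn : m ≤ n)
    (hnm : n ≤ m + 6 * k) (hn : (n : ℝ) * q ^ k ≤ k) (hn' : (k : ℝ) ≤ (n + 1) * q ^ k)
    (hkq : k * q ^ k ≤ 1) (hk6 : 6 * q ^ k ≤ 1) {r : Fin 3 → Fin 3 → ℕ} (hr : ∀ i j, r i j ≤ k) :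
    (1 - 6 * q ^ k + 6 * q ^ (2 * k) + ∑ i, ∑ j, q ^ (2 * k - r i j)) ^ m ≤
      exp 48 * exp (-(6 * k)) * exp (∑ j, ∑ i, k * q ^ (k - r i j)) := by
  have hmq : (m : ℝ) * q ^ k ≤ k := le_trans (by gcongr) hn
  have hmq' : (k : ℝ) - 7 ≤ m * q ^ k := by
    have : (n : ℝ) * q ^ k ≤ (m + 6 * k) * q ^ k := by
      gcongr
      exact_mod_cast hnm
    have := pow_le_one₀ h0.le h1.le (n := k)
    linarith
  have hsum : (m : ℝ) * ∑ i, ∑ j, q ^ (2 * k - r i j) ≤ ∑ j, ∑ i, k * q ^ (k - r i j) := by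
    rw [Finset.sum_comm, Finset.mul_sum]
    refine Finset.sum_le_sum fun j _ => ?_
    rw [Finset.mul_sum]
    refine Finset.sum_le_sum fun i _ => ?_
    have := hr i j
    rw [show 2 * k - r i j = k + (k - r i j) by omega, pow_add, ← mul_assoc]
    gcongr
  have hsq : (m : ℝ) * (6 * q ^ (2 * k)) ≤ 6 := by
    rw [two_mul, pow_add]
    have : (m : ℝ) * q ^ k * q ^ k ≤ k * q ^ k := by gcongr
    linarith
  have hnonneg : 0 ≤ 1 - 6 * q ^ k + 6 * q ^ (2 * k) + ∑ i, ∑ j, q ^ (2 * k - r i j) := by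
    have : 0 ≤ 6 * q ^ (2 * k) + ∑ i, ∑ j, q ^ (2 * k - r i j) := by positivity
    linarith
  have hle : 1 - 6 * q ^ k + 6 * q ^ (2 * k) + ∑ i, ∑ j, q ^ (2 * k - r i j) ≤
      exp (-(6 * q ^ k) + 6 * q ^ (2 * k) + ∑ i, ∑ j, q ^ (2 * k - r i j)) :=
    le_trans (by linarith) (add_one_le_exp _)
  refine (pow_le_pow_left₀ hnonneg hle m).trans ?_
  rw [← exp_nat_mul, ← exp_add, ← exp_add, exp_le_exp]
  linarith

/-- A bound, up to a constant factor, for the probability that two families with intersection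
sizes `r` are simultaneously special. -/
noncomputable def pairBound (q : ℝ) (k : ℕ) (r : Fin 3 → Fin 3 → ℕ) : ℝ :=
  q ^ (6 * k ^ 2) / q ^ overlap r * exp (-(6 * k)) * exp (∑ j, ∑ i, k * q ^ (k - r i j))

lemma pairBound_nonneg {q : ℝ} (h0 : 0 ≤ q) (k : ℕ) (r : Fin 3 → Fin 3 → ℕ) :
    0 ≤ pairBound q k r := by
  unfold pairBound
  positivity

lemma choose_le_pow_div_factorial_div {q : ℝ} (h0 : 0 < q) {n k : ℕ}
    (hn : (n : ℝ) * q ^ k ≤ k) (m : ℕ) :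
    (n.choose m : ℝ) ≤ (k : ℝ) ^ m / m.factorial / q ^ (k * m) := by
  refine (Nat.choose_le_pow_div m n).trans ?_
  rw [div_right_comm, pow_mul, ← div_pow]
  gcongr
  rwa [le_div_iff₀ (by positivity)]

lemma prod_mul_pairBound_le {q : ℝ} (h0 : 0 < q) {n k f : ℕ}
    (hn : (n : ℝ) * q ^ k ≤ k) {r : Fin 3 → Fin 3 → ℕ} (hcol : ∀ j, ∑ i, r i j ≤ k)
    (hf : k * ∑ j, ∑ i, r i j = overlap r + f) :
    (∏ j, ((∏ i, (k.choose (r i j) : ℝ)) * (n.choose (k - ∑ i, r i j) : ℝ))) * pairBound q k r ≤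
      q ^ (3 * k ^ 2) * exp (-(3 * k)) * ((∏ j, columnTerm q k fun i => r i j) * q ^ f) := by
  have hle : ∏ j, ((∏ i, (k.choose (r i j) : ℝ)) * (n.choose (k - ∑ i, r i j) : ℝ)) ≤
      ∏ j, ((∏ i, (k.choose (r i j) : ℝ)) * ((k : ℝ) ^ (k - ∑ i, r i j) /
        (k - ∑ i, r i j).factorial / q ^ (k * (k - ∑ i, r i j)))) :=
    Finset.prod_le_prod (fun _ _ => by positivity) fun j _ => by
      gcongr
      exact choose_le_pow_div_factorial_div h0 hn _
  refine (mul_le_mul_of_nonneg_right hle (pairBound_nonneg h0.le k r)).trans_eq ?_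
  have hexp : exp (-(6 * (k : ℝ))) = exp (-(3 * k)) * ∏ _j : Fin 3, exp (-(k : ℝ)) := by
    rw [Finset.prod_const, Finset.card_univ, Fintype.card_fin, ← exp_nat_mul, ← exp_add]
    congr 1
    push_cast
    ring
  have hpow : q ^ (6 * k ^ 2) = q ^ (3 * k ^ 2) * (∏ j, q ^ (k * (k - ∑ i, r i j))) *
      (q ^ overlap r * q ^ f) := by
    rw [Finset.prod_pow_eq_pow_sum, ← pow_add, ← pow_add, ← pow_add, ← hf, ← Finset.mul_sum]
    congr 1
    have : ∑ j, (k - ∑ i, r i j) + ∑ j, ∑ i, r i j = 3 * k := by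
      rw [← Finset.sum_add_distrib]
      simp [hcol]
    rw [add_assoc, ← mul_add, this]
    ring
  simp only [pairBound, columnTerm, Finset.prod_mul_distrib, Finset.prod_div_distrib, exp_sum,
    hexp, hpow]
  field_simp

lemma pairBound_le_of_perm {q : ℝ} (h0 : 0 < q) (h1 : q < 1) {k : ℕ} (hkq : k * q ^ k ≤ 1)
    {r : Fin 3 → Fin 3 → ℕ} (hrow : ∀ i, ∑ j, r i j ≤ k) (hcol : ∀ j, ∑ i, r i j ≤ k)
    (hr : ∀ j, ∃ i, r i j = k) :
    pairBound q k r ≤ q ^ (3 * k ^ 2) * exp (-(3 * k)) * exp 6 := by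
  obtain ⟨f, hf, -⟩ := exists_add_overlap_eq hrow hcol
  have hov : overlap r ≤ 3 * k ^ 2 := by
    have : ∑ j, ∑ i, r i j ≤ 3 * k :=
      (Finset.sum_le_card_nsmul _ _ k fun j _ => hcol j).trans (by simp)
    nlinarith
  have hq : q ^ (6 * k ^ 2) / q ^ overlap r ≤ q ^ (3 * k ^ 2) := by
    rw [div_eq_mul_inv, ← pow_sub₀ q h0.ne' (by omega)]
    exact pow_le_pow_of_le_one h0.le h1.le (by omega)
  have hsum : ∑ j, ∑ i, k * q ^ (k - r i j) ≤ 3 * k + 6 := by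
    refine (Finset.sum_le_card_nsmul _ _ ((k : ℝ) + 2) fun j _ => ?_).trans ?_
    · obtain ⟨i, hi⟩ := hr j
      refine sum_mul_pow_sub_le h0.le h1.le (b := 0) (by simpa using hkq) (i := i) ?_
      intro i' hne
      have := (Finset.add_sum_erase Finset.univ (fun i => r i j) (Finset.mem_univ i)).trans_le
        (hcol j)
      have := Finset.single_le_sum (f := fun i => r i j) (fun _ _ => Nat.zero_le _)
        (Finset.mem_erase.2 ⟨hne, Finset.mem_univ i'⟩)
      omega
    · simp
      linarith
  calc pairBound q k r ≤ q ^ (3 * k ^ 2) * exp (-(6 * k)) * exp (3 * k + 6) := by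
        unfold pairBound
        gcongr
    _ = q ^ (3 * k ^ 2) * exp (-(3 * k)) * exp 6 := by
        rw [mul_assoc, mul_assoc, ← exp_add, ← exp_add]
        congr 2
        ring

/-- The families of three pairwise disjoint `k`-sets in `Fin n`. -/
noncomputable def disjointFamilies (n k : ℕ) : Finset (Fin 3 → Finset (Fin n)) :=
  open Classical in Finset.univ.filter fun A =>
    (Pairwise fun i j => Disjoint (A i) (A j)) ∧ ∀ i, (A i).card = k

lemma mem_disjointFamilies {n k : ℕ} {A : Fin 3 → Finset (Fin n)} :
    A ∈ disjointFamilies n k ↔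
      (Pairwise fun i j => Disjoint (A i) (A j)) ∧ ∀ i, (A i).card = k := by
  simp [disjointFamilies]

lemma card_disjointFamilies_le (n k : ℕ) : (disjointFamilies n k).card ≤ n.choose k ^ 3 := by
  refine (Finset.card_le_card (t := Fintype.piFinset fun _ => Finset.univ.powersetCard k)
    fun A hA => ?_).trans_eq ?_
  · simpa [Fintype.mem_piFinset, Finset.mem_powersetCard] using (mem_disjointFamilies.1 hA).2
  · simp [Fintype.card_piFinset, Finset.card_powersetCard]

lemma SpecialTuple.isSpecialFamily {n : ℕ} {G : SimpleGraph (Fin n)} {X₁ X₂ X₃ : Finset (Fin n)}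
    {x₁ x₂ x₃ : Fin n} (h : SpecialTuple G X₁ X₂ X₃ x₁ x₂ x₃) :
    IsSpecialFamily G ![X₁, X₂, X₃] ![x₁, x₂, x₃] := by
  obtain ⟨-, -, -, -, -, -, h, h12, h13, h23⟩ := h
  refine ⟨fun v hv i => ?_, fun i j hij => ?_⟩
  · obtain ⟨g1, g2, g3⟩ := h v (hv 0) (hv 1) (hv 2)
    fin_cases i
    exacts [g1, g2, g3]
  · fin_cases i <;> fin_cases j <;>
      first | exact h12 | exact h13 | exact h23 | exact absurd hij (by decide)

open Classical in
lemma countX_le_sum {n : ℕ} (G : SimpleGraph (Fin n)) (k : ℕ) :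
    (countX G k k k : ℝ) ≤ ∑ A ∈ disjointFamilies n k, ∑ a ∈ Fintype.piFinset A,
      if IsSpecialFamily G A a then 1 else 0 := by
  have hsum : ∑ A ∈ disjointFamilies n k, ∑ a ∈ Fintype.piFinset A,
      (if IsSpecialFamily G A a then (1 : ℝ) else 0) =
      (((disjointFamilies n k).sigma fun A => Fintype.piFinset A).filter
        fun t => IsSpecialFamily G t.1 t.2).card := by
    rw [Finset.card_filter, Finset.sum_sigma]
    push_cast
    rfl
  rw [hsum, Nat.cast_le, countX, Nat.card_eq_fintype_card, ← Finset.card_univ]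
  refine Finset.card_le_card_of_injOn
    (fun t => ⟨![t.1.1, t.1.2.1, t.1.2.2.1], ![t.1.2.2.2.1, t.1.2.2.2.2.1, t.1.2.2.2.2.2]⟩) ?_ ?_
  · rintro ⟨⟨X₁, X₂, X₃, x₁, x₂, x₃⟩, h1, h2, h3, h⟩ -
    have hF := h.isSpecialFamily
    obtain ⟨d12, d13, d23, m1, m2, m3, -⟩ := h
    simp only [Finset.coe_filter, Finset.mem_sigma, Fintype.mem_piFinset, mem_disjointFamilies,
      Set.mem_ofPred_eq]
    refine ⟨⟨⟨fun i j hij => ?_, fun i => ?_⟩, fun i => ?_⟩, hF⟩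
    · fin_cases i <;> fin_cases j <;>
        first
        | exact absurd rfl hij
        | exact d12
        | exact d13
        | exact d23
        | exact d12.symm
        | exact d13.symm
        | exact d23.symm
    · fin_cases i
      exacts [h1, h2, h3]
    · fin_cases i
      exacts [m1, m2, m3]
  · rintro ⟨⟨X₁, X₂, X₃, x₁, x₂, x₃⟩, -⟩ - ⟨⟨Y₁, Y₂, Y₃, y₁, y₂, y₃⟩, -⟩ -
    intro h
    simp only [Sigma.mk.injEq, heq_eq_eq] at h
    obtain ⟨h1, h2⟩ := h
    have e1 := congrFun h1 0
    have e2 := congrFun h1 1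
    have e3 := congrFun h1 2
    have e4 := congrFun h2 0
    have e5 := congrFun h2 1
    have e6 := congrFun h2 2
    simp only [Matrix.cons_val] at e1 e2 e3 e4 e5 e6
    subst e1 e2 e3 e4 e5 e6
    rfl

open Classical in
/-- The probability that both `(A, a)` and `(B, b)` are special in `G(n,p)`. -/
noncomputable def pairProb (n : ℕ) (p : ℝ) (A : Fin 3 → Finset (Fin n)) (a : Fin 3 → Fin n)
    (B : Fin 3 → Finset (Fin n)) (b : Fin 3 → Fin n) : ℝ :=
  ∑ G, gnpWeight n p G * (if IsSpecialFamily G A a ∧ IsSpecialFamily G B b then 1 else 0)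

lemma integral_countX_sq_le {n : ℕ} {p : ℝ} (h0 : 0 ≤ p) (h1 : p ≤ 1) (k : ℕ) :
    (∫ G, ((countX G k k k : ℝ)) ^ 2 ∂ gnp n p) ≤
      ∑ A ∈ disjointFamilies n k, ∑ a ∈ Fintype.piFinset A,
        ∑ B ∈ disjointFamilies n k, ∑ b ∈ Fintype.piFinset B, pairProb n p A a B b := by
  classical
  rw [integral_gnp h0 h1]
  calc ∑ G, gnpWeight n p G * ((countX G k k k : ℝ)) ^ 2
      ≤ ∑ G, gnpWeight n p G * (∑ A ∈ disjointFamilies n k, ∑ a ∈ Fintype.piFinset A,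
        if IsSpecialFamily G A a then 1 else 0) ^ 2 := by
        refine Finset.sum_le_sum fun G _ => ?_
        refine mul_le_mul_of_nonneg_left ?_ (gnpWeight_nonneg h0 h1 G)
        gcongr
        convert countX_le_sum G k
    _ = ∑ A ∈ disjointFamilies n k, ∑ a ∈ Fintype.piFinset A,
        ∑ B ∈ disjointFamilies n k, ∑ b ∈ Fintype.piFinset B, pairProb n p A a B b := by
        simp only [pairProb, sq, Finset.sum_mul, Finset.mul_sum, ite_and]
        rw [Finset.sum_comm]
        refine Finset.sum_congr rfl fun A _ => ?_
        rw [Finset.sum_comm]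
        refine Finset.sum_congr rfl fun a _ => ?_
        rw [Finset.sum_comm]
        refine Finset.sum_congr rfl fun B _ => ?_
        rw [Finset.sum_comm]
        refine Finset.sum_congr rfl fun b _ => Finset.sum_congr rfl fun G _ => ?_
        split_ifs <;> simp

/-- The matrix of intersection sizes of two families. -/
def interCard {V : Type*} [DecidableEq V] (A B : Fin 3 → Finset V) : Fin 3 → Fin 3 → ℕ :=
  fun i j => (A i ∩ B j).card

lemma sum_card_inter_le {V : Type*} [DecidableEq V] {B : Fin 3 → Finset V}
    (hB : Pairwise fun i j => Disjoint (B i) (B j)) (S : Finset V) :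
    ∑ j, (S ∩ B j).card ≤ S.card := by
  rw [← Finset.card_biUnion fun i _ j _ hij =>
    (hB hij).mono Finset.inter_subset_right Finset.inter_subset_right]
  exact Finset.card_le_card (Finset.biUnion_subset.2 fun _ _ => Finset.inter_subset_left)

lemma sum_interCard_row_le {n k : ℕ} {A B : Fin 3 → Finset (Fin n)}
    (hA : A ∈ disjointFamilies n k) (hB : B ∈ disjointFamilies n k) (i : Fin 3) :
    ∑ j, interCard A B i j ≤ k :=
  (sum_card_inter_le (mem_disjointFamilies.1 hB).1 (A i)).trans_eq
    ((mem_disjointFamilies.1 hA).2 i)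

lemma sum_interCard_col_le {n k : ℕ} {A B : Fin 3 → Finset (Fin n)}
    (hA : A ∈ disjointFamilies n k) (hB : B ∈ disjointFamilies n k) (j : Fin 3) :
    ∑ i, interCard A B i j ≤ k := by
  simp only [interCard, Finset.inter_comm _ (B j)]
  exact (sum_card_inter_le (mem_disjointFamilies.1 hA).1 (B j)).trans_eq
    ((mem_disjointFamilies.1 hB).2 j)

lemma interCard_le {n k : ℕ} {A B : Fin 3 → Finset (Fin n)}
    (hA : A ∈ disjointFamilies n k) (i j : Fin 3) : interCard A B i j ≤ k :=
  (Finset.card_le_card Finset.inter_subset_left).trans_eq ((mem_disjointFamilies.1 hA).2 i)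

lemma eq_of_interCard_eq {n k : ℕ} {A B : Fin 3 → Finset (Fin n)}
    (hA : A ∈ disjointFamilies n k) (hB : B ∈ disjointFamilies n k) {i j : Fin 3}
    (h : interCard A B i j = k) : B j = A i := by
  have h1 : A i ∩ B j = A i := Finset.eq_of_subset_of_card_le Finset.inter_subset_left
    (((mem_disjointFamilies.1 hA).2 i).trans h.symm).le
  have h2 : A i ∩ B j = B j := Finset.eq_of_subset_of_card_le Finset.inter_subset_right
    (((mem_disjointFamilies.1 hB).2 j).trans h.symm).le
  rw [← h2, h1]

lemma pairProb_le {p : ℝ} (h0 : 0 < p) (h1 : p < 1) {k : ℕ}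
    (hkq : k * (1 - p) ^ k ≤ 1) (hk6 : 6 * (1 - p) ^ k ≤ 1)
    {A B : Fin 3 → Finset (Fin (nseq2 p k))} (hA : A ∈ disjointFamilies _ k)
    (hB : B ∈ disjointFamilies _ k) (a b : Fin 3 → Fin (nseq2 p k)) :
    pairProb _ p A a B b ≤ exp 48 / (1 - p) ^ 6 * pairBound (1 - p) k (interCard A B) := by
  have hq0 : 0 < 1 - p := by linarith
  obtain ⟨m, hmn, hnm, hle⟩ := sum_gnpWeight_two_families_le h0 h1 a b
    (mem_disjointFamilies.1 hA).1 (mem_disjointFamilies.1 hA).2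
    (mem_disjointFamilies.1 hB).1 (mem_disjointFamilies.1 hB).2 hk6
  have hpow := bonferroni_pow_le hq0 (by linarith) hmn hnm (nseq2_mul_pow_le h1 k)
    (le_nseq2_add_one_mul_pow h1 k) hkq hk6 (r := interCard A B) fun i j => interCard_le hA i j
  refine hle.trans ((mul_le_mul_of_nonneg_left hpow (by positivity)).trans_eq ?_)
  rw [pairBound, pow_add]
  change (1 - p) ^ (6 * k ^ 2) / ((1 - p) ^ overlap (interCard A B) * _) * _ = _
  field_simp

lemma exists_eq_of_pairProb_ne_zero {n k : ℕ} {p : ℝ} {A B : Fin 3 → Finset (Fin n)}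
    (hA : A ∈ disjointFamilies n k) (hB : B ∈ disjointFamilies n k)
    (hperm : ∀ j, ∃ i, interCard A B i j = k) {a b : Fin 3 → Fin n}
    (hb : b ∈ Fintype.piFinset B) (h : pairProb n p A a B b ≠ 0) (j : Fin 3) :
    ∃ i, b j = a i := by
  obtain ⟨G, -, hG⟩ := Finset.exists_ne_zero_of_sum_ne_zero h
  have hG' : IsSpecialFamily G A a ∧ IsSpecialFamily G B b := by
    by_contra hne
    simp [hne] at hG
  obtain ⟨⟨-, hGA⟩, -, hGB⟩ := hG'
  rw [Fintype.mem_piFinset] at hb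
  obtain ⟨j', hj'⟩ := exists_ne j
  obtain ⟨i, hi⟩ := hperm j
  obtain ⟨i', hi'⟩ := hperm j'
  have hBj := eq_of_interCard_eq hA hB hi
  have hBj' := eq_of_interCard_eq hA hB hi'
  have hii : i ≠ i' := by
    rintro rfl
    exact hj' (eq_of_mem_of_mem (mem_disjointFamilies.1 hB).1 (hb j') (by
      rw [hBj, ← hBj']
      exact hb j'))
  have hadj : G.Adj (b j) (b j') := by
    rcases lt_or_gt_of_ne hj' with hlt | hlt
    · exact ((hGB j' j hlt _ (hb j') _ (hb j)).2 ⟨rfl, rfl⟩).symm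
    · exact (hGB j j' hlt _ (hb j) _ (hb j')).2 ⟨rfl, rfl⟩
  refine ⟨i, ?_⟩
  rcases lt_or_gt_of_ne hii with hlt | hlt
  · exact ((hGA i i' hlt _ (hBj ▸ hb j) _ (hBj' ▸ hb j')).1 hadj).1
  · exact ((hGA i' i hlt _ (hBj' ▸ hb j') _ (hBj ▸ hb j)).1 hadj.symm).2

open Classical in
lemma sum_pairProb_perm_le {n k : ℕ} {p M : ℝ} (hM : 0 ≤ M) {A : Fin 3 → Finset (Fin n)}
    (hA : A ∈ disjointFamilies n k) (a : Fin 3 → Fin n)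
    (hle : ∀ B ∈ disjointFamilies n k, (∀ j, ∃ i, interCard A B i j = k) →
      ∀ b, pairProb n p A a B b ≤ M) :
    ∑ B ∈ (disjointFamilies n k).filter (fun B => ∀ j, ∃ i, interCard A B i j = k),
      ∑ b ∈ Fintype.piFinset B, pairProb n p A a B b ≤ 729 * M := by
  have hcard : ∀ {α : Type} [DecidableEq α] (c : Fin 3 → α),
      ((Finset.univ.image fun (σ : Fin 3 → Fin 3) (j : Fin 3) => c (σ j)).card : ℝ) ≤ 27 := by
    intro α _ c
    have : (Finset.univ.image fun (σ : Fin 3 → Fin 3) (j : Fin 3) => c (σ j)).card ≤ 27 :=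
      Finset.card_image_le.trans (by simp)
    exact_mod_cast this
  have hinner : ∀ B ∈ (disjointFamilies n k).filter (fun B => ∀ j, ∃ i, interCard A B i j = k),
      ∑ b ∈ Fintype.piFinset B, pairProb n p A a B b ≤ 27 * M := by
    intro B hB
    obtain ⟨hB, hperm⟩ := Finset.mem_filter.1 hB
    rw [← Finset.sum_filter_ne_zero]
    refine (Finset.sum_le_card_nsmul _ _ M fun b _ => hle B hB hperm b).trans ?_
    rw [nsmul_eq_mul]
    refine mul_le_mul_of_nonneg_right (le_trans ?_ (hcard a)) hM
    refine Nat.cast_le.2 (Finset.card_le_card fun b hb => ?_)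
    obtain ⟨hb, hne⟩ := Finset.mem_filter.1 hb
    choose σ hσ using exists_eq_of_pairProb_ne_zero hA hB hperm hb hne
    exact Finset.mem_image.2 ⟨σ, Finset.mem_univ _, funext fun j => (hσ j).symm⟩
  refine (Finset.sum_le_card_nsmul _ _ _ hinner).trans ?_
  rw [nsmul_eq_mul, show (729 : ℝ) * M = 27 * (27 * M) by ring]
  refine mul_le_mul_of_nonneg_right (le_trans ?_ (hcard A)) (by positivity)
  refine Nat.cast_le.2 (Finset.card_le_card fun B hB => ?_)
  obtain ⟨hB, hperm⟩ := Finset.mem_filter.1 hB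
  choose σ hσ using hperm
  exact Finset.mem_image.2 ⟨σ, Finset.mem_univ _,
    funext fun j => (eq_of_interCard_eq hA hB (hσ j)).symm⟩

open Classical in
lemma sum_pairBound_nonperm_le {q : ℝ} (h0 : 0 < q) {n k : ℕ} (hk : 1 ≤ k)
    (hn : (n : ℝ) * q ^ k ≤ k) (hkq : k * q ^ k ≤ 1)
    (hterm : ∀ (r : Fin 3 → Fin 3 → ℕ) (f : ℕ), (∀ i, ∑ j, r i j ≤ k) →
      (∀ j, ∑ i, r i j ≤ k) → k * ∑ j, ∑ i, r i j = overlap r + f → r ≠ 0 →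
      (¬ ∀ j, ∃ i, r i j = k) →
      ((k : ℝ) + 1) ^ 9 * k ^ 3 * ((∏ j, columnTerm q k fun i => r i j) * q ^ f) ≤ 1)
    {A : Fin 3 → Finset (Fin n)} (hA : A ∈ disjointFamilies n k) :
    ∑ B ∈ (disjointFamilies n k).filter (fun B => ¬ ∀ j, ∃ i, interCard A B i j = k),
      k ^ 3 * pairBound q k (interCard A B) ≤ q ^ (3 * k ^ 2) * exp (-(3 * k)) *
        (1 + k ^ 3 * ((k : ℝ) ^ k / k.factorial * exp (-k) * exp 3) ^ 3) := by
  set F := (disjointFamilies n k).filter (fun B => ¬ ∀ j, ∃ i, interCard A B i j = k) with hF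
  set y := (k : ℝ) ^ k / k.factorial * exp (-k) * exp 3 with hy
  have hy0 : 0 ≤ y := by positivity
  have hk0 : (0 : ℝ) < k := by exact_mod_cast hk
  set R := Fintype.piFinset fun _ : Fin 3 => Fintype.piFinset fun _ : Fin 3 =>
    Finset.range (k + 1) with hR
  have hmaps : ∀ B ∈ F, interCard A B ∈ R := by
    intro B hB
    simp only [hR, Fintype.mem_piFinset, Finset.mem_range]
    exact fun i j => Nat.lt_succ_of_le (interCard_le hA i j)
  have hRcard : (R.card : ℝ) = ((k : ℝ) + 1) ^ 9 := by
    simp [hR, Fintype.card_piFinset, ← pow_mul]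
  have hfiber : ∀ r ∈ R, ∑ B ∈ F.filter (fun B => interCard A B = r),
      k ^ 3 * pairBound q k (interCard A B) ≤ q ^ (3 * k ^ 2) * exp (-(3 * k)) *
        ((((k : ℝ) + 1) ^ 9)⁻¹ + if r = 0 then k ^ 3 * y ^ 3 else 0) := by
    intro r _
    rcases (F.filter (fun B => interCard A B = r)).eq_empty_or_nonempty with he | ⟨B, hB⟩
    · rw [he, Finset.sum_empty]
      positivity
    obtain ⟨hBF, rfl⟩ := Finset.mem_filter.1 hB
    obtain ⟨hBd, hnp⟩ := Finset.mem_filter.1 hBF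
    have hrow := sum_interCard_row_le hA hBd
    have hcol := sum_interCard_col_le hA hBd
    set r := interCard A B with hr
    obtain ⟨f, hf, -⟩ := exists_add_overlap_eq hrow hcol
    have hcount : ((F.filter (fun B => interCard A B = r)).card : ℝ) ≤
        ∏ j, ((∏ i, (k.choose (r i j) : ℝ)) * (n.choose (k - ∑ i, r i j) : ℝ)) := by
      have h := card_filter_card_inter_families_le (mem_disjointFamilies.1 hA).1
        (mem_disjointFamilies.1 hA).2 r
      rw [Fintype.card_fin] at h
      have hsub := (Finset.card_le_card (s := F.filter fun B => interCard A B = r)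
        fun B' hB' => by
          obtain ⟨hB'F, hB'r⟩ := Finset.mem_filter.1 hB'
          exact Finset.mem_filter.2 ⟨Finset.mem_univ _,
            (mem_disjointFamilies.1 (Finset.mem_filter.1 hB'F).1).2, hB'r⟩).trans h
      exact_mod_cast hsub
    have hsum : ∑ B ∈ F.filter (fun B => interCard A B = r),
        k ^ 3 * pairBound q k (interCard A B) =
        k ^ 3 * ((F.filter (fun B => interCard A B = r)).card * pairBound q k r) := by
      rw [Finset.sum_congr rfl (g := fun _ => k ^ 3 * pairBound q k r)
        fun B' hB' => by rw [(Finset.mem_filter.1 hB').2], Finset.sum_const, nsmul_eq_mul]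
      ring
    have hcol' : k ^ 3 * ((∏ j, columnTerm q k fun i => r i j) * q ^ f) ≤
        (((k : ℝ) + 1) ^ 9)⁻¹ + if r = 0 then k ^ 3 * y ^ 3 else 0 := by
      by_cases hr0 : r = 0
      · rw [if_pos hr0]
        have hf0 : f = 0 := by
          simp [hr0] at hf
          omega
        have hz := columnTerm_zero_le hkq
        have : (∏ j, columnTerm q k fun i => r i j) * q ^ f ≤ y ^ 3 := by
          rw [hf0, hr0, pow_zero, mul_one]
          simp only [Pi.zero_apply, Finset.prod_const, Finset.card_univ, Fintype.card_fin]
          exact pow_le_pow_left₀ (columnTerm_nonneg _ _ _) hz 3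
        have h9 : 0 ≤ (((k : ℝ) + 1) ^ 9)⁻¹ := by positivity
        nlinarith [pow_pos hk0 3]
      · rw [if_neg hr0, add_zero, ← one_div, le_div_iff₀ (by positivity)]
        linarith [hterm r f hrow hcol hf hr0 hnp]
    rw [hsum]
    calc k ^ 3 * ((F.filter (fun B => interCard A B = r)).card * pairBound q k r)
        ≤ k ^ 3 * (q ^ (3 * k ^ 2) * exp (-(3 * k)) *
          ((∏ j, columnTerm q k fun i => r i j) * q ^ f)) := by
          refine mul_le_mul_of_nonneg_left ?_ (by positivity)
          exact (mul_le_mul_of_nonneg_right hcount (pairBound_nonneg h0.le k r)).trans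
            (prod_mul_pairBound_le h0 hn hcol hf)
      _ = q ^ (3 * k ^ 2) * exp (-(3 * k)) *
          (k ^ 3 * ((∏ j, columnTerm q k fun i => r i j) * q ^ f)) := by ring
      _ ≤ _ := by gcongr
  rw [← Finset.sum_fiberwise_of_maps_to hmaps]
  refine (Finset.sum_le_sum hfiber).trans ?_
  rw [← Finset.mul_sum, Finset.sum_add_distrib, Finset.sum_const, nsmul_eq_mul, hRcard,
    mul_inv_cancel₀ (by positivity), Finset.sum_ite_eq']
  gcongr
  split_ifs
  · exact le_rfl
  · positivity

lemma card_piFinset_of_mem_disjointFamilies {n k : ℕ} {A : Fin 3 → Finset (Fin n)}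
    (hA : A ∈ disjointFamilies n k) : (Fintype.piFinset A).card = k ^ 3 := by
  simp [Fintype.card_piFinset, (mem_disjointFamilies.1 hA).2]

lemma sum_pairProb_le {p : ℝ} (h0 : 0 < p) (h1 : p < 1) {k : ℕ} (hk : 1 ≤ k)
    (hkq : k * (1 - p) ^ k ≤ 1) (hk6 : 6 * (1 - p) ^ k ≤ 1)
    (hterm : ∀ (r : Fin 3 → Fin 3 → ℕ) (f : ℕ), (∀ i, ∑ j, r i j ≤ k) →
      (∀ j, ∑ i, r i j ≤ k) → k * ∑ j, ∑ i, r i j = overlap r + f → r ≠ 0 →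
      (¬ ∀ j, ∃ i, r i j = k) →
      ((k : ℝ) + 1) ^ 9 * k ^ 3 * ((∏ j, columnTerm (1 - p) k fun i => r i j) * (1 - p) ^ f) ≤ 1)
    {A : Fin 3 → Finset (Fin (nseq2 p k))} (hA : A ∈ disjointFamilies _ k)
    (a : Fin 3 → Fin (nseq2 p k)) :
    ∑ B ∈ disjointFamilies _ k, ∑ b ∈ Fintype.piFinset B, pairProb _ p A a B b ≤
      exp 48 / (1 - p) ^ 6 * ((1 - p) ^ (3 * k ^ 2) * exp (-(3 * k)) *
        (729 * exp 6 + 1 + k ^ 3 * ((k : ℝ) ^ k / k.factorial * exp (-k)) ^ 3 * exp 9)) := by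
  classical
  have hq0 : 0 < 1 - p := by linarith
  rw [← Finset.sum_filter_add_sum_filter_not _ fun B => ∀ j, ∃ i, interCard A B i j = k]
  have hperm := sum_pairProb_perm_le (p := p)
    (M := exp 48 / (1 - p) ^ 6 * ((1 - p) ^ (3 * k ^ 2) * exp (-(3 * k)) * exp 6))
    (by positivity) hA a fun B hB hB' b => (pairProb_le h0 h1 hkq hk6 hA hB a b).trans (by
      gcongr
      exact pairBound_le_of_perm hq0 (by linarith) hkq (sum_interCard_row_le hA hB)
        (sum_interCard_col_le hA hB) hB')
  have hnonperm : ∑ B ∈ (disjointFamilies (nseq2 p k) k).filter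
      (fun B => ¬ ∀ j, ∃ i, interCard A B i j = k),
      ∑ b ∈ Fintype.piFinset B, pairProb _ p A a B b ≤ exp 48 / (1 - p) ^ 6 *
        ((1 - p) ^ (3 * k ^ 2) * exp (-(3 * k)) *
          (1 + k ^ 3 * ((k : ℝ) ^ k / k.factorial * exp (-k) * exp 3) ^ 3)) := by
    refine le_trans ?_ (mul_le_mul_of_nonneg_left
      (sum_pairBound_nonperm_le hq0 hk (nseq2_mul_pow_le h1 k) hkq hterm hA) (by positivity))
    rw [Finset.mul_sum]
    refine Finset.sum_le_sum fun B hB => ?_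
    have hB := (Finset.mem_filter.1 hB).1
    refine (Finset.sum_le_card_nsmul _ _ _ fun b _ =>
      pairProb_le h0 h1 hkq hk6 hA hB a b).trans_eq ?_
    rw [card_piFinset_of_mem_disjointFamilies hB, nsmul_eq_mul]
    push_cast
    ring
  refine (add_le_add hperm hnonperm).trans_eq ?_
  rw [mul_pow _ (exp 3), ← exp_nat_mul 3 3]
  norm_num
  ring

theorem stmt14 {p : ℝ} (hp : p ∈ Set.Ioo (0 : ℝ) 1) :
    ∃ c : ℝ, 0 < c ∧ ∃ K : ℕ, ∀ k : ℕ, K ≤ k →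
      (∫ G, ((countX G k k k : ℝ)) ^ 2 ∂ gnp (nseq2 p k) p) ≤ c * (k : ℝ) ^ 3 := by
  obtain ⟨h0, h1⟩ := hp
  have hq0 : 0 < 1 - p := by linarith
  have hq1 : 1 - p < 1 := by linarith
  refine ⟨exp 48 / (1 - p) ^ 6 * (729 * exp 6 + 1 + exp 9), by positivity,
    eventually_atTop.1 ?_⟩
  filter_upwards [eventually_ge_atTop 1, eventually_mul_pow_mul_pow_le_one 1 1 hq0.le hq1,
    eventually_mul_pow_mul_pow_le_one 6 0 hq0.le hq1,
    eventually_mul_prod_columnTerm_le_one hq0 hq1] with k hk hkq hk6 hterm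
  simp only [pow_one, one_mul, pow_zero, mul_one] at hkq hk6
  set y := (k : ℝ) ^ k / k.factorial * exp (-k) with hy
  have hy0 : 0 ≤ y := by positivity
  have hcard : ((disjointFamilies (nseq2 p k) k).card : ℝ) ≤
      ((k : ℝ) ^ k / k.factorial / (1 - p) ^ (k * k)) ^ 3 := by
    refine (Nat.cast_le.2 (card_disjointFamilies_le _ _)).trans ?_
    push_cast
    gcongr
    exact choose_le_pow_div_factorial_div hq0 (nseq2_mul_pow_le h1 k) k
  set T := exp 48 / (1 - p) ^ 6 * ((1 - p) ^ (3 * k ^ 2) * exp (-(3 * k)) *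
    (729 * exp 6 + 1 + k ^ 3 * y ^ 3 * exp 9)) with hT
  have hT0 : 0 ≤ T := by positivity
  calc (∫ G, ((countX G k k k : ℝ)) ^ 2 ∂ gnp (nseq2 p k) p)
      ≤ ∑ A ∈ disjointFamilies (nseq2 p k) k, ∑ a ∈ Fintype.piFinset A,
        ∑ B ∈ disjointFamilies (nseq2 p k) k, ∑ b ∈ Fintype.piFinset B, pairProb _ p A a B b :=
        integral_countX_sq_le h0.le h1.le k
    _ ≤ ∑ A ∈ disjointFamilies (nseq2 p k) k, (k : ℝ) ^ 3 * T := by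
        refine Finset.sum_le_sum fun A hA => ?_
        refine (Finset.sum_le_card_nsmul _ _ T fun a _ =>
          sum_pairProb_le h0 h1 hk hkq hk6 hterm hA a).trans_eq ?_
        rw [card_piFinset_of_mem_disjointFamilies hA, nsmul_eq_mul, Nat.cast_pow]
    _ ≤ ((k : ℝ) ^ k / k.factorial / (1 - p) ^ (k * k)) ^ 3 * (k ^ 3 * T) := by
        rw [Finset.sum_const, nsmul_eq_mul]
        gcongr
    _ = exp 48 / (1 - p) ^ 6 * (y ^ 3 * (729 * exp 6 + 1) + y ^ 6 * k ^ 3 * exp 9) * k ^ 3 := by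
        have hexp : exp (-(3 * (k : ℝ))) = exp (-k) ^ 3 := by
          rw [← exp_nat_mul]
          congr 1
          push_cast
          ring
        have hpow : (1 - p) ^ (3 * k ^ 2) = ((1 - p) ^ (k * k)) ^ 3 := by
          rw [← pow_mul]
          congr 1
          ring
        rw [hT, hexp, hpow, hy]
        field_simp
    _ ≤ exp 48 / (1 - p) ^ 6 * (1 * (729 * exp 6 + 1) + 1 * exp 9) * k ^ 3 := by
        gcongr
        · exact pow_le_one₀ hy0 (pow_div_factorial_mul_exp_neg_le_one k)
        · exact pow_div_factorial_mul_exp_neg_pow_six_le k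
    _ = exp 48 / (1 - p) ^ 6 * (729 * exp 6 + 1 + exp 9) * k ^ 3 := by ring
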